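/- arXiv:1303.0854 — 4 statements merged into one kernel-verified Lean document; each statement's English description precedes it below -/
import Mathlib

section
/- For all m ≥ 1 and all n ≥ 4 + m, the highest power of x that occurs in the polynomial Q_{n,132}^{(1,2,m,0)}(x) is x^{n-3-m}, and its coefficient equals 5·C_m; that is, the coefficient of x^{n-3-m} in Q_{n,132}^{(1,2,m,0)}(x) is 5·C_m and the coefficient of x^r is 0 for every r > n-3-m. -/
open Finset Polynomial

/-- `σ i` matches the quadrant marked mesh pattern `MMP(a,b,c,d)` in `σ`:
there are at least `a` indices `j > i` with `σ j > σ i`, at least `b` indices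
`j < i` with `σ j > σ i`, at least `c` indices `j < i` with `σ j < σ i`, and
at least `d` indices `j > i` with `σ j < σ i`. -/
def MatchesMMP {n : ℕ} (a b c d : ℕ) (σ : Equiv.Perm (Fin n)) (i : Fin n) : Prop :=
  a ≤ (Finset.univ.filter (fun j => i < j ∧ σ i < σ j)).card ∧
  b ≤ (Finset.univ.filter (fun j => j < i ∧ σ i < σ j)).card ∧
  c ≤ (Finset.univ.filter (fun j => j < i ∧ σ j < σ i)).card ∧
  d ≤ (Finset.univ.filter (fun j => i < j ∧ σ j < σ i)).card

instance {n : ℕ} (a b c d : ℕ) (σ : Equiv.Perm (Fin n)) :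
    DecidablePred (MatchesMMP a b c d σ) := fun i => by
  unfold MatchesMMP; infer_instance

/-- `mmp a b c d σ` is the number of indices `i` such that `σ i` matches
`MMP(a,b,c,d)` in `σ`. -/
def mmp {n : ℕ} (a b c d : ℕ) (σ : Equiv.Perm (Fin n)) : ℕ :=
  (Finset.univ.filter (MatchesMMP a b c d σ)).card

/-- `σ` avoids the classical pattern 132. -/
def Avoids132 {n : ℕ} (σ : Equiv.Perm (Fin n)) : Prop :=
  ¬ ∃ i j k : Fin n, i < j ∧ j < k ∧ σ i < σ k ∧ σ k < σ j

instance {n : ℕ} : DecidablePred (Avoids132 (n := n)) := fun σ => by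
  unfold Avoids132; infer_instance

/-- The set `S_n(132)` of 132-avoiding permutations of `{1,…,n}`. -/
def Av132 (n : ℕ) : Finset (Equiv.Perm (Fin n)) :=
  Finset.univ.filter Avoids132

/-- `Q n a b c d = Σ_{σ ∈ S_n(132)} x^{mmp^{(a,b,c,d)}(σ)}`, a polynomial in `ℤ[x]`. -/
noncomputable def Q (n a b c d : ℕ) : Polynomial ℤ :=
  ∑ σ ∈ Av132 n, Polynomial.X ^ (mmp a b c d σ)



def AvL : List ℕ → Prop
  | [] => True
  | a :: l => l.Pairwise (fun c b => ¬ (a < b ∧ b < c)) ∧ AvL l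

lemma avL_iff (l : List ℕ) : AvL l ↔ ∀ i j k (hi : i < j) (hj : j < k) (hk : k < l.length),
    ¬ (l[i] < l[k] ∧ l[k] < l[j]) := by
  induction l with
  | nil => simp [AvL]
  | cons a l ih =>
    rw [AvL, ih, List.pairwise_iff_getElem]
    constructor
    · rintro ⟨h1, h2⟩ i j k hi hj hk
      obtain ⟨k, rfl⟩ : ∃ k', k = k' + 1 := ⟨k - 1, by omega⟩
      obtain ⟨j, rfl⟩ : ∃ k', j = k' + 1 := ⟨j - 1, by omega⟩
      simp only [List.length_cons] at hk
      cases i with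
      | zero => exact h1 j k (by omega) (by omega) (by omega)
      | succ i => exact h2 i j k (by omega) (by omega) (by omega)
    · intro h
      refine ⟨fun j k hj hk hjk => ?_, fun i j k hi hj hk => ?_⟩
      · exact h 0 (j+1) (k+1) (by omega) (by omega) (by simp; omega)
      · exact h (i+1) (j+1) (k+1) (by omega) (by omega) (by simp; omega)

lemma avL_split (l1 l2 : List ℕ) (n : ℕ) (h1 : ∀ x ∈ l1, x < n) (h2 : ∀ x ∈ l2, x < n) :
    AvL (l1 ++ n :: l2) ↔ AvL l1 ∧ AvL l2 ∧ ∀ a ∈ l1, ∀ b ∈ l2, b ≤ a := by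
  induction l1 with
  | nil =>
    simp only [List.nil_append, AvL, List.not_mem_nil, true_and]
    refine ⟨fun h => ⟨h.2, by simp⟩, fun h => ⟨?_, h.1⟩⟩
    rw [List.pairwise_iff_forall_sublist]; intro c b hs; have hc := hs.subset (List.mem_cons_self); have hb := hs.subset (by simp : b ∈ [c, b])
    have := h2 b hb
    omega
  | cons a l ih =>
    have ih := ih (fun x hx => h1 x (by simp [hx]))
    have ha := h1 a (by simp)
    simp only [List.cons_append, AvL, ih, List.pairwise_append, List.pairwise_cons, List.mem_cons]
    constructor
    · rintro ⟨⟨p1, ⟨p2, p3⟩, p4⟩, q1, q2, q3⟩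
      refine ⟨⟨p1, q1⟩, q2, ?_⟩
      rintro x (rfl | hx) b hb
      · have := p2 b hb
        have := h2 b hb
        omega
      · exact q3 x hx b hb
    · rintro ⟨⟨p1, q1⟩, q2, q3⟩
      refine ⟨⟨p1, ⟨?_, ?_⟩, ?_⟩, q1, q2, fun x hx => q3 x (Or.inr hx)⟩
      · intro b hb
        have := q3 a (Or.inl rfl) b hb
        omega
      · rw [List.pairwise_iff_forall_sublist]; intro c b hs; have hc := hs.subset (List.mem_cons_self); have hb := hs.subset (by simp : b ∈ [c, b])
        have := q3 a (Or.inl rfl) b hb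
        omega
      · rintro c hc b (rfl | hb)
        · have := h1 c (by simp [hc])
          omega
        · have := q3 a (Or.inl rfl) b hb
          omega

lemma perm_range_iff (l : List ℕ) (k : ℕ) :
    l.Perm (List.range k) ↔ l.Nodup ∧ (∀ x ∈ l, x < k) ∧ l.length = k := by
  constructor
  · intro h
    refine ⟨h.nodup_iff.2 List.nodup_range, fun x hx => by simpa using h.mem_iff.1 hx, by simpa using h.length_eq⟩
  · rintro ⟨h1, h2, h3⟩
    refine (List.subperm_of_subset h1 (fun x hx => by simpa using h2 x hx)).perm_of_length_le ?_
    simp [h3]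

lemma avL_map_add (l : List ℕ) (j : ℕ) : AvL (l.map (· + j)) ↔ AvL l := by
  induction l with
  | nil => simp [AvL]
  | cons a l ih => simp [AvL, ih, List.pairwise_map]

open Classical in
noncomputable def AvF (n : ℕ) : Finset (List ℕ) :=
  ((List.range n).permutations.toFinset).filter AvL

lemma mem_AvF (n : ℕ) (l : List ℕ) :
    l ∈ AvF n ↔ (l.Nodup ∧ (∀ x ∈ l, x < n) ∧ l.length = n) ∧ AvL l := by
  simp [AvF, ← perm_range_iff]

lemma card_AvF_succ (n : ℕ) :
    (AvF (n + 1)).card = ∑ p ∈ antidiagonal n, (AvF p.1).card * (AvF p.2).card := by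
  simp_rw [← Finset.card_product]
  rw [← Finset.card_sigma]
  symm
  refine Finset.card_bij (fun q _ => q.2.1.map (· + q.1.2) ++ n :: q.2.2) ?_ ?_ ?_
  · rintro ⟨⟨i, j⟩, l1, l2⟩ h
    simp only [Finset.mem_sigma, HasAntidiagonal.mem_antidiagonal, Finset.mem_product, mem_AvF] at h ⊢
    obtain ⟨hij, ⟨⟨a1, a2, a3⟩, a4⟩, ⟨⟨b1, b2, b3⟩, b4⟩⟩ := h
    refine ⟨⟨?_, ?_, ?_⟩, ?_⟩
    · rw [List.nodup_append]
      refine ⟨a1.map (fun x y h => by simpa using h), ?_, ?_⟩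
      · rw [List.nodup_cons]
        exact ⟨fun h => by have := b2 _ h; omega, b1⟩
      · intro x hx y hy
        simp only [List.mem_map, List.mem_cons] at hx hy
        obtain ⟨x, hx, rfl⟩ := hx
        have := a2 x hx
        rcases hy with rfl | hy
        · omega
        · have := b2 y hy
          omega
    · intro x hx
      simp only [List.mem_append, List.mem_map, List.mem_cons] at hx
      rcases hx with ⟨x, hx, rfl⟩ | rfl | hx
      · have := a2 x hx
        omega
      · omega
      · have := b2 x hx
        omega
    · simp; omega
    · rw [avL_split, avL_map_add]
      · refine ⟨a4, b4, ?_⟩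
        simp only [List.mem_map]
        rintro _ ⟨x, hx, rfl⟩ y hy
        have := b2 y hy
        omega
      · simp only [List.mem_map]
        rintro _ ⟨x, hx, rfl⟩
        have := a2 x hx
        omega
      · intro y hy
        have := b2 y hy
        omega
  · rintro ⟨⟨i, j⟩, l1, l2⟩ h ⟨⟨i', j'⟩, l1', l2'⟩ h' heq
    simp only [Finset.mem_sigma, HasAntidiagonal.mem_antidiagonal, Finset.mem_product, mem_AvF] at h h' heq
    obtain ⟨hij, ⟨⟨a1, a2, a3⟩, a4⟩, ⟨⟨b1, b2, b3⟩, b4⟩⟩ := h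
    obtain ⟨hij', ⟨⟨a1', a2', a3'⟩, a4'⟩, ⟨⟨b1', b2', b3'⟩, b4'⟩⟩ := h'
    rw [List.append_cons_inj_of_notMem] at heq
    · obtain ⟨e1, -, rfl⟩ := heq
      obtain rfl : j = j' := by omega
      obtain rfl : i = i' := by omega
      have : l1 = l1' := List.map_injective_iff.2 (fun x y h => by simpa using h) e1
      rw [this]
    · simp only [List.mem_map]
      rintro ⟨x, hx, e⟩
      have := a2 x hx
      omega
    · intro hx
      have := b2 _ hx
      omega
  · intro l hl
    have hp := hl
    rw [mem_AvF] at hl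
    obtain ⟨⟨a1, a2, a3⟩, a4⟩ := hl
    have hmem : ∀ x, x < n + 1 → x ∈ l := by
      intro x hx
      rw [((perm_range_iff l (n+1)).2 ⟨a1, a2, a3⟩).mem_iff]
      simpa using hx
    obtain ⟨l1, l2, rfl⟩ := List.append_of_mem (hmem n (by omega))
    have nd := a1
    rw [List.nodup_append, List.nodup_cons] at a1
    obtain ⟨c1, ⟨c2, c3⟩, c4⟩ := a1
    have h1 : ∀ x ∈ l1, x < n := by
      intro x hx
      have := a2 x (by simp [hx])
      have := c4 x hx n (by simp)
      omega
    have h2 : ∀ x ∈ l2, x < n := by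
      intro x hx
      have := a2 x (by simp [hx])
      have : x ≠ n := by rintro rfl; exact c2 hx
      omega
    rw [avL_split _ _ _ h1 h2] at a4
    obtain ⟨d1, d2, d3⟩ := a4
    have e2 : ∀ x ∈ l2, x < l2.length := by
      intro x hx
      have : Finset.range (x+1) ⊆ l2.toFinset := by
        intro y hy
        rw [Finset.mem_range] at hy
        have hxn := h2 x hx
        have := hmem y (by omega)
        simp only [List.mem_append, List.mem_cons] at this
        rw [List.mem_toFinset]
        rcases this with h | h | h
        · have := d3 y h x hx
          have := c4 y h x (by simp [hx])
          omega
        · omega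
        · exact h
      have := Finset.card_le_card this
      rw [List.toFinset_card_of_nodup c3, Finset.card_range] at this
      omega
    have e1 : ∀ y ∈ l1, l2.length ≤ y := by
      intro y hy
      have : l2.toFinset ⊆ Finset.range y := by
        intro x hx
        rw [List.mem_toFinset] at hx
        have := d3 y hy x hx
        have := c4 y hy x (by simp [hx])
        rw [Finset.mem_range]
        omega
      have := Finset.card_le_card this
      rwa [List.toFinset_card_of_nodup c3, Finset.card_range] at this
    simp only [List.length_append, List.length_cons] at a3
    have emap : (l1.map (· - l2.length)).map (· + l2.length) = l1 := by
      rw [List.map_map]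
      conv_rhs => rw [← List.map_id l1]
      refine List.map_congr_left ?_
      intro y hy
      have := e1 y hy
      simp; omega
    refine ⟨⟨(l1.length, l2.length), (l1.map (· - l2.length), l2)⟩, ?_, ?_⟩
    · simp only [Finset.mem_sigma, HasAntidiagonal.mem_antidiagonal, Finset.mem_product, mem_AvF]
      refine ⟨by omega, ⟨⟨?_, ?_, by simp⟩, ?_⟩, ⟨c3, e2, trivial⟩, d2⟩
      · exact List.Nodup.of_map _ (emap ▸ c1)
      · simp only [List.mem_map]
        rintro _ ⟨x, hx, rfl⟩
        have := e1 x hx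
        have := h1 x hx
        omega
      · rw [← avL_map_add _ l2.length, emap]; exact d1
    · simp only [emap]

lemma card_AvF (n : ℕ) : (AvF n).card = catalan n := by
  induction n using Nat.strong_induction_on with
  | _ n ih =>
    cases n with
    | zero =>
      have : AvF 0 = {[]} := by
        ext l
        rw [mem_AvF]
        constructor
        · intro h; simpa using h.1.2.2
        · intro h
          simp only [Finset.mem_singleton] at h
          subst h
          simp [AvL]
      simp [this]
    | succ n =>
      rw [card_AvF_succ, catalan_succ']
      refine Finset.sum_congr rfl ?_
      rintro ⟨i, j⟩ h
      rw [HasAntidiagonal.mem_antidiagonal] at h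
      simp only at h
      rw [ih i (by omega), ih j (by omega)]

lemma fwd_facts {m n : ℕ} (hm : 1 ≤ m) (hn : 4 + m ≤ n) (σ : Equiv.Perm (Fin n))
    (hav : Avoids132 σ)
    (hmt : ∀ i : Fin n, m + 2 ≤ i.val → i.val + 1 < n → MatchesMMP 1 2 m 0 σ i) :
    (∀ i j : Fin n, j.val < 2 → m + 2 ≤ i.val → i.val + 1 < n → σ i < σ j) ∧
    (∀ i : Fin n, m + 2 ≤ i.val → i.val + 1 < n → (σ i).val + 2 = i.val) ∧
    (∀ i : Fin n, 2 ≤ i.val → i.val < m + 2 → (σ i).val < m) ∧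
    (∀ i : Fin n, i.val + 1 = n → n ≤ (σ i).val + 3) := by
  have hav' : ∀ i j k : Fin n, i < j → j < k → σ i < σ k → σ k < σ j → False :=
    fun i j k h1 h2 h3 h4 => hav ⟨i, j, k, h1, h2, h3, h4⟩
  have hne : ∀ i j : Fin n, i < j → σ i ≠ σ j := fun i j h e => by
    have := σ.injective e
    omega
  have A : ∀ i j : Fin n, j.val < 2 → m + 2 ≤ i.val → i.val + 1 < n → σ i < σ j := by
    intro i j hj h1 h2
    by_contra hcon
    have hc := (hmt i h1 h2).2.1
    have hji : j < i := by rw [Fin.lt_def]; omega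
    have hlt : σ j < σ i := lt_of_le_of_ne (not_lt.1 hcon) (hne j i hji)
    have hsub : (Finset.univ.filter (fun k => k < i ∧ σ i < σ k)) ⊆ Finset.Iio j := by
      intro k hk
      simp only [Finset.mem_filter, Finset.mem_univ, true_and, Finset.mem_Iio] at hk ⊢
      by_contra hkj
      rcases eq_or_lt_of_le (not_lt.1 hkj) with rfl | hkj
      · exact hcon hk.2
      · exact hav' j k i hkj hk.1 hlt hk.2
    have := Finset.card_le_card hsub
    rw [Fin.card_Iio] at this
    omega
  have B : ∀ i j : Fin n, m + 2 ≤ i.val → i.val + 1 < n → i.val ≤ j.val + m → j < i → σ j < σ i := by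
    intro i j h1 h2 h3 hji
    by_contra hcon
    have hc := (hmt i h1 h2).2.2.1
    have hlt : σ i < σ j := lt_of_le_of_ne (not_lt.1 hcon) (hne j i hji).symm
    have hsub : (Finset.univ.filter (fun k => k < i ∧ σ k < σ i)) ⊆ Finset.Ioo j i := by
      intro k hk
      simp only [Finset.mem_filter, Finset.mem_univ, true_and, Finset.mem_Ioo] at hk ⊢
      refine ⟨?_, hk.1⟩
      by_contra hkj
      rcases eq_or_lt_of_le (not_lt.1 hkj) with rfl | hkj
      · exact hcon hk.2
      · exact hav' k j i hkj hji hk.2 hlt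
    have := Finset.card_le_card hsub
    rw [Fin.card_Ioo] at this
    rw [Fin.lt_def] at hji
    omega
  have C : ∀ i j : Fin n, j.val + 1 = n → i.val + 2 = n → σ i < σ j := by
    intro i j hj hi
    have hc := (hmt i (by omega) (by omega)).1
    obtain ⟨k, hk⟩ := Finset.card_pos.1 (lt_of_lt_of_le Nat.zero_lt_one hc)
    simp only [Finset.mem_filter, Finset.mem_univ, true_and] at hk
    have : k = j := by
      have := hk.1
      rw [Fin.lt_def] at this
      ext
      omega
    rw [← this]
    exact hk.2
  have D1 : ∀ i j : Fin n, m + 2 ≤ i.val → j.val = i.val + 1 → σ i < σ j := by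
    intro i j hi hj
    by_cases h : j.val + 1 = n
    · exact C i j h (by omega)
    · exact B j i (by omega) (by omega) (by omega) (by rw [Fin.lt_def]; omega)
  have D : ∀ (d : ℕ) (i j : Fin n), m + 2 ≤ i.val → j.val = i.val + 1 + d → σ i < σ j := by
    intro d
    induction d with
    | zero => intro i j hi hj; exact D1 i j hi hj
    | succ d ih =>
      intro i j hi hj
      have hk : i.val + 1 + d < n := by omega
      exact (ih i ⟨_, hk⟩ hi rfl).trans (D1 ⟨_, hk⟩ j (by simp only; omega) (by simp only; omega))
  have E0 : ∀ j i : Fin n, 2 ≤ j.val → j.val < m + 2 → i.val = m + 2 → σ j < σ i := by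
    intro j i h1 h2 h3
    exact B i j (by omega) (by omega) (by omega) (by rw [Fin.lt_def]; omega)
  have E : ∀ j i : Fin n, 2 ≤ j.val → j < i → m + 2 ≤ i.val → σ j < σ i := by
    intro j i h1 h2 h3
    rw [Fin.lt_def] at h2
    by_cases h4 : m + 2 ≤ j.val
    · exact D (i.val - j.val - 1) j i h4 (by omega)
    · by_cases h5 : i.val = m + 2
      · exact E0 j i h1 (by omega) h5
      · have hk : m + 2 < n := by omega
        exact (E0 j ⟨_, hk⟩ h1 (by omega) rfl).trans
          (D (i.val - (m + 2) - 1) ⟨_, hk⟩ i (by simp) (by simp only; omega))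
  have V : ∀ i : Fin n, m + 2 ≤ i.val → i.val + 1 < n → (σ i).val + 2 = i.val := by
    intro i h1 h2
    have h2n : 2 < n := by omega
    have hset : (Finset.Ico (⟨2, h2n⟩ : Fin n) i).map σ.toEmbedding = Finset.Iio (σ i) := by
      ext v
      simp only [Finset.mem_map, Finset.mem_Ico, Finset.mem_Iio, Equiv.coe_toEmbedding]
      constructor
      · rintro ⟨k, ⟨hk1, hk2⟩, rfl⟩
        exact E k i hk1 hk2 h1
      · intro hv
        refine ⟨σ.symm v, ⟨?_, ?_⟩, by simp⟩
        · by_contra hcon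
          have := A i (σ.symm v) (by simpa [Fin.lt_def] using hcon) h1 h2
          simp only [Equiv.apply_symm_apply] at this
          exact absurd hv (not_lt.2 this.le)
        · by_contra hcon
          rcases eq_or_lt_of_le (not_lt.1 hcon) with h | h
          · rw [h] at hv
            simp at hv
          · have := E i (σ.symm v) (by omega) h (by rw [Fin.lt_def] at h; omega)
            simp only [Equiv.apply_symm_apply] at this
            exact absurd hv (not_lt.2 this.le)
    have := congrArg Finset.card hset
    rw [Finset.card_map, Fin.card_Ico, Fin.card_Iio] at this
    simp only at this
    omega
  refine ⟨A, V, ?_, ?_⟩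
  · intro i h1 h2
    have hk : m + 2 < n := by omega
    have h := E0 i ⟨_, hk⟩ h1 h2 rfl
    have h' := V ⟨_, hk⟩ (by simp) (by simp only; omega)
    rw [Fin.lt_def] at h
    simp only at h'
    omega
  · intro i h1
    have hk : n - 2 < n := by omega
    have h := C ⟨_, hk⟩ i h1 (by simp only; omega)
    have h' := V ⟨_, hk⟩ (by simp only; omega) (by simp only; omega)
    rw [Fin.lt_def] at h
    simp only at h'
    omega

def JSet (m n : ℕ) : Finset (Fin n) := Finset.univ.filter (fun i => m + 2 ≤ i.val ∧ i.val + 1 < n)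

lemma card_JSet (m n : ℕ) (hn : 4 + m ≤ n) : (JSet m n).card = n - 3 - m := by
  have : JSet m n = Finset.Ico (⟨m + 2, by omega⟩ : Fin n) ⟨n - 1, by omega⟩ := by
    ext i
    simp only [JSet, Finset.mem_filter, Finset.mem_univ, true_and, Finset.mem_Ico, Fin.le_def,
      Fin.lt_def]
    omega
  rw [this, Fin.card_Ico]
  simp only
  omega

lemma filter_subset_JSet (m n : ℕ) (σ : Equiv.Perm (Fin n)) :
    Finset.univ.filter (MatchesMMP 1 2 m 0 σ) ⊆ JSet m n := by
  intro i hi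
  simp only [JSet, Finset.mem_filter, Finset.mem_univ, true_and] at hi ⊢
  obtain ⟨h1, h2, h3, -⟩ := hi
  constructor
  · have hd : Disjoint (Finset.univ.filter (fun j => j < i ∧ σ i < σ j))
        (Finset.univ.filter (fun j => j < i ∧ σ j < σ i)) := by
      rw [Finset.disjoint_left]
      intro k hk hk'
      simp only [Finset.mem_filter, Finset.mem_univ, true_and] at hk hk'
      exact absurd hk.2 (not_lt.2 hk'.2.le)
    have hsub : (Finset.univ.filter (fun j => j < i ∧ σ i < σ j)) ∪
        (Finset.univ.filter (fun j => j < i ∧ σ j < σ i)) ⊆ Finset.Iio i := by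
      intro k hk
      simp only [Finset.mem_union, Finset.mem_filter, Finset.mem_univ, true_and,
        Finset.mem_Iio] at hk ⊢
      rcases hk with hk | hk <;> exact hk.1
    have := Finset.card_le_card hsub
    rw [Finset.card_union_of_disjoint hd, Fin.card_Iio] at this
    omega
  · obtain ⟨k, hk⟩ := Finset.card_pos.1 (lt_of_lt_of_le Nat.zero_lt_one h1)
    simp only [Finset.mem_filter, Finset.mem_univ, true_and, Fin.lt_def] at hk
    omega

lemma mmp_le (m n : ℕ) (hn : 4 + m ≤ n) (σ : Equiv.Perm (Fin n)) :
    mmp 1 2 m 0 σ ≤ n - 3 - m := by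
  rw [← card_JSet m n hn]
  exact Finset.card_le_card (filter_subset_JSet m n σ)

lemma mmp_eq_iff (m n : ℕ) (hn : 4 + m ≤ n) (σ : Equiv.Perm (Fin n)) :
    mmp 1 2 m 0 σ = n - 3 - m ↔
      ∀ i : Fin n, m + 2 ≤ i.val → i.val + 1 < n → MatchesMMP 1 2 m 0 σ i := by
  rw [← card_JSet m n hn]
  constructor
  · intro h i h1 h2
    have := Finset.eq_of_subset_of_card_le (filter_subset_JSet m n σ) h.ge
    have hi : i ∈ JSet m n := by simp [JSet, h1, h2]
    rw [← this] at hi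
    simpa using hi
  · intro h
    unfold mmp
    congr 1
    refine Finset.Subset.antisymm (filter_subset_JSet m n σ) ?_
    intro i hi
    simp only [JSet, Finset.mem_filter, Finset.mem_univ, true_and] at hi ⊢
    exact h i hi.1 hi.2

def toL {n : ℕ} (σ : Equiv.Perm (Fin n)) : List ℕ := List.ofFn (fun i => (σ i).val)

lemma toL_inj {n : ℕ} : Function.Injective (toL (n := n)) := by
  intro σ τ h
  have := List.ofFn_injective h
  ext i
  exact congrFun this i

lemma toL_surj {n : ℕ} (l : List ℕ) (h1 : l.Nodup) (h2 : ∀ x ∈ l, x < n) (h3 : l.length = n) :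
    ∃ σ : Equiv.Perm (Fin n), toL σ = l := by
  subst h3
  let f : Fin l.length → Fin l.length := fun i => ⟨l[i], h2 _ (by simp)⟩
  have hf : Function.Injective f := by
    intro i j h
    simp only [f, Fin.mk.injEq] at h
    exact Fin.ext ((h1.getElem_inj_iff).1 h)
  refine ⟨Equiv.ofBijective f (Finite.injective_iff_bijective.1 hf), ?_⟩
  simp [toL, f]

lemma avL_toL {n : ℕ} (σ : Equiv.Perm (Fin n)) : AvL (toL σ) ↔ Avoids132 σ := by
  rw [avL_iff]
  constructor
  · rintro h ⟨i, j, k, hij, hjk, h1, h2⟩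
    refine h i j k hij hjk (by simp [toL]) ?_
    simpa [toL] using ⟨h1, h2⟩
  · intro h i j k hij hjk hk hh
    have hk' : k < n := by simpa [toL] using hk
    refine h ⟨⟨i, by omega⟩, ⟨j, by omega⟩, ⟨k, hk'⟩, hij, hjk, ?_⟩
    simpa [toL] using hh

def Trip : Finset (ℕ × ℕ × ℕ) := {(0,1,2),(1,0,2),(1,2,0),(2,0,1),(2,1,0)}

lemma mem_Trip (a b c : ℕ) : (a, b, c) ∈ Trip ↔ a < 3 ∧ b < 3 ∧ c < 3 ∧ a ≠ b ∧ a ≠ c ∧ b ≠ c ∧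
    ¬ (a < c ∧ c < b) := by
  simp only [Trip, Finset.mem_insert, Finset.mem_singleton, Prod.mk.injEq]
  omega

def build (m n : ℕ) (t : ℕ × ℕ × ℕ) (l : List ℕ) : List ℕ :=
  (n - 3 + t.1) :: (n - 3 + t.2.1) :: (l ++ (List.range' m (n - 3 - m) ++ [n - 3 + t.2.2]))

lemma avL_append (l1 l2 : List ℕ) (h1 : AvL l1) (h2 : l2.Pairwise (· < ·))
    (h : ∀ a ∈ l1, ∀ b ∈ l2, a < b) : AvL (l1 ++ l2) := by
  induction l1 with
  | nil =>
    rw [List.nil_append]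
    clear h h1
    induction l2 with
    | nil => trivial
    | cons a l ih =>
      rw [List.pairwise_cons] at h2
      exact ⟨h2.2.imp (by omega), ih h2.2⟩
  | cons a l ih =>
    refine ⟨?_, ih h1.2 (fun x hx => h x (by simp [hx]))⟩
    change List.Pairwise _ (l ++ l2)
    rw [List.pairwise_append]
    refine ⟨h1.1, h2.imp (by omega), ?_⟩
    intro x hx y hy
    have := h x (by simp [hx]) y hy
    omega

lemma avL_build (m n : ℕ) (hn : 4 + m ≤ n) (a b c : ℕ) (ht : (a, b, c) ∈ Trip) (l : List ℕ)
    (hl : l ∈ AvF m) : AvL (build m n (a, b, c) l) := by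
  rw [mem_Trip] at ht
  rw [mem_AvF] at hl
  obtain ⟨⟨a1, a2, a3⟩, a4⟩ := hl
  have hs : ∀ x ∈ l ++ List.range' m (n - 3 - m), x < n - 3 := by
    intro x hx
    simp only [List.mem_append, List.mem_range'_1] at hx
    rcases hx with hx | hx
    · have := a2 x hx
      omega
    · omega
  have key : ∀ y, (l ++ (List.range' m (n - 3 - m) ++ [n - 3 + c])).Pairwise
      (fun cc bb => ¬ (n - 3 + y < bb ∧ bb < cc)) := by
    intro y
    rw [← List.append_assoc, List.pairwise_append]
    refine ⟨?_, by simp, ?_⟩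
    · refine List.pairwise_of_forall_mem_list ?_
      intro u hu v hv
      have := hs v hv
      omega
    · intro u hu v hv
      have := hs u hu
      simp only [List.mem_singleton] at hv
      omega
  refine ⟨?_, key b, ?_⟩
  · rw [List.pairwise_cons]
    refine ⟨?_, key a⟩
    intro v hv
    rw [← List.append_assoc, List.mem_append, List.mem_singleton] at hv
    rcases hv with hv | hv
    · have := hs v hv
      omega
    · simp only
      omega
  · refine avL_append _ _ a4 ?_ ?_
    · rw [List.pairwise_append]
      refine ⟨List.pairwise_lt_range', by simp, ?_⟩
      intro u hu v hv
      have := hs u (by simp only [List.mem_append]; exact Or.inr hu)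
      simp only [List.mem_singleton] at hv
      omega
    · intro u hu v hv
      have := a2 u hu
      simp only [List.mem_append, List.mem_range'_1, List.mem_singleton] at hv
      omega

lemma nodup_build (m n : ℕ) (hn : 4 + m ≤ n) (a b c : ℕ) (ht : (a, b, c) ∈ Trip) (l : List ℕ)
    (hl : l ∈ AvF m) : (build m n (a, b, c) l).Nodup ∧ (∀ x ∈ build m n (a, b, c) l, x < n) ∧
      (build m n (a, b, c) l).length = n := by
  rw [mem_Trip] at ht
  rw [mem_AvF] at hl
  obtain ⟨⟨a1, a2, a3⟩, a4⟩ := hl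
  refine ⟨?_, ?_, ?_⟩
  · simp only [build, List.nodup_cons, List.nodup_append, List.mem_cons, List.mem_append,
      List.mem_range'_1, List.not_mem_nil, or_false, not_or]
    refine ⟨⟨by omega, fun h => ?_, by omega, by omega⟩, ⟨fun h => ?_, by omega, by omega⟩, a1,
      ⟨List.nodup_range', ⟨by simp, by simp⟩, ?_⟩, ?_⟩
    · have := a2 _ h
      omega
    · have := a2 _ h
      omega
    · intro u hu v hv
      omega
    · intro u hu v hv
      have := a2 _ hu
      omega
  · intro x hx
    simp only [build, List.mem_cons, List.mem_append,
      List.mem_range'_1, List.not_mem_nil, or_false] at hx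
    rcases hx with hx | hx | hx | hx | hx
    · omega
    · omega
    · have := a2 _ hx
      omega
    · omega
    · omega
  · simp only [build, List.length_cons, List.length_append, List.length_range', List.length_nil]
    omega

lemma build_get (m n : ℕ) (hn : 4 + m ≤ n) (t : ℕ × ℕ × ℕ) (l : List ℕ) (hl : l.length = m)
    (i : ℕ) (hi : i < (build m n t l).length) :
    (build m n t l)[i] = if i = 0 then n - 3 + t.1 else if i = 1 then n - 3 + t.2.1 else
      if h : i - 2 < l.length then l[i - 2] else if i + 1 < n then i - 2 else n - 3 + t.2.2 := by
  match i, hi with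
  | 0, _ => simp [build]
  | 1, _ => simp [build]
  | i + 2, hi =>
    simp only [build, List.length_cons, List.length_append, List.length_range', List.length_nil]
      at hi
    rw [if_neg (by omega : ¬ (i + 2 = 0)), if_neg (by omega : ¬ (i + 2 = 1))]
    simp only [Nat.add_sub_cancel]
    simp only [build, List.getElem_cons_succ, List.getElem_append, List.length_range',
      List.getElem_range', List.getElem_singleton]
    split_ifs <;> first | rfl | omega

lemma matches_build (m n : ℕ) (hn : 4 + m ≤ n) (t : ℕ × ℕ × ℕ) (l : List ℕ)
    (hl : l ∈ AvF m) (σ : Equiv.Perm (Fin n)) (hσ : toL σ = build m n t l)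
    (i : Fin n) (h1 : m + 2 ≤ i.val) (h2 : i.val + 1 < n) : MatchesMMP 1 2 m 0 σ i := by
  rw [mem_AvF] at hl
  obtain ⟨⟨a1, a2, a3⟩, a4⟩ := hl
  have hlen : (build m n t l).length = n := by rw [← hσ]; simp [toL]
  have hv : ∀ j : Fin n, (σ j).val = if j.val = 0 then n - 3 + t.1 else
      if j.val = 1 then n - 3 + t.2.1 else
      if h : j.val - 2 < l.length then l[j.val - 2] else
      if j.val + 1 < n then j.val - 2 else n - 3 + t.2.2 := by
    intro j
    rw [← build_get m n hn t l a3 j.val (by omega)]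
    have : (toL σ)[j.val]'(by simp [toL]) = (σ j).val := by simp [toL]
    rw [← this]
    congr 1
  have hvi : (σ i).val = i.val - 2 := by
    rw [hv i, if_neg (by omega), if_neg (by omega), dif_neg (by omega), if_pos h2]
  refine ⟨?_, ?_, ?_, Nat.zero_le _⟩
  · rw [Nat.succ_le_iff, Finset.card_pos]
    refine ⟨⟨n - 1, by omega⟩, ?_⟩
    simp only [Finset.mem_filter, Finset.mem_univ, true_and, Fin.lt_def]
    rw [hv ⟨n - 1, by omega⟩, hvi]
    simp only
    rw [if_neg (by omega), if_neg (by omega), dif_neg (by omega), if_neg (by omega)]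
    omega
  · have hsub : Finset.Iio (⟨2, by omega⟩ : Fin n) ⊆
        Finset.univ.filter (fun j => j < i ∧ σ i < σ j) := by
      intro j hj
      simp only [Finset.mem_filter, Finset.mem_univ, true_and, Finset.mem_Iio, Fin.lt_def] at hj ⊢
      rw [hvi, hv j]
      split_ifs <;> omega
    have := Finset.card_le_card hsub
    rwa [Fin.card_Iio] at this
  · have hsub : Finset.Ico (⟨2, by omega⟩ : Fin n) ⟨m + 2, by omega⟩ ⊆
        Finset.univ.filter (fun j => j < i ∧ σ j < σ i) := by
      intro j hj
      simp only [Finset.mem_filter, Finset.mem_univ, true_and, Finset.mem_Ico, Fin.lt_def,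
        Fin.le_def] at hj ⊢
      rw [hvi, hv j, if_neg (by omega), if_neg (by omega), dif_pos (by omega)]
      have := a2 (l[j.val - 2]'(by omega)) (List.getElem_mem _)
      omega
    have := Finset.card_le_card hsub
    rw [Fin.card_Ico] at this
    simpa using this

lemma exists_build (m n : ℕ) (hm : 1 ≤ m) (hn : 4 + m ≤ n) (σ : Equiv.Perm (Fin n))
    (hav : Avoids132 σ)
    (hmt : ∀ i : Fin n, m + 2 ≤ i.val → i.val + 1 < n → MatchesMMP 1 2 m 0 σ i) :
    ∃ t ∈ Trip, ∃ l ∈ AvF m, build m n t l = toL σ := by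
  obtain ⟨A, V, S, Z⟩ := fwd_facts hm hn σ hav hmt
  have hn2 : n - 2 < n := by omega
  let i0 : Fin n := ⟨0, by omega⟩
  let i1 : Fin n := ⟨1, by omega⟩
  let il : Fin n := ⟨n - 1, by omega⟩
  have hV := V ⟨n - 2, hn2⟩ (by simp only; omega) (by simp only; omega)
  have hA0 := A ⟨n - 2, hn2⟩ i0 (by simp [i0]) (by simp only; omega) (by simp only; omega)
  have hA1 := A ⟨n - 2, hn2⟩ i1 (by simp [i1]) (by simp only; omega) (by simp only; omega)
  have hZ := Z il (by simp only [il]; omega)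
  have n01 : (σ i0).val ≠ (σ i1).val := fun h => by
    have := congrArg Fin.val (σ.injective (Fin.ext h)); simp [i0, i1] at this
  have n0l : (σ i0).val ≠ (σ il).val := fun h => by
    have := congrArg Fin.val (σ.injective (Fin.ext h)); simp only [i0, il] at this; omega
  have n1l : (σ i1).val ≠ (σ il).val := fun h => by
    have := congrArg Fin.val (σ.injective (Fin.ext h)); simp only [i1, il] at this; omega
  have nav : ¬ ((σ i0).val < (σ il).val ∧ (σ il).val < (σ i1).val) := fun h =>
    hav ⟨i0, i1, il, by simp [i0, i1, Fin.lt_def], by simp only [i1, il, Fin.lt_def]; omega, h.1, h.2⟩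
  rw [Fin.lt_def] at hA0 hA1
  simp only at hV
  let l : List ℕ := List.ofFn (fun k : Fin m => (σ ⟨k.val + 2, by omega⟩).val)
  have hll : l.length = m := by simp [l]
  refine ⟨((σ i0).val - (n - 3), (σ i1).val - (n - 3), (σ il).val - (n - 3)), ?_, l, ?_, ?_⟩
  · rw [mem_Trip]
    omega
  · rw [mem_AvF]
    refine ⟨⟨?_, ?_, hll⟩, ?_⟩
    · refine List.nodup_ofFn.2 ?_
      intro x y h
      have := congrArg Fin.val (σ.injective (Fin.ext h))
      simp only at this
      ext
      omega
    · intro x hx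
      simp only [l, List.mem_ofFn] at hx
      obtain ⟨k, rfl⟩ := hx
      exact S _ (by simp) (by simp)
    · rw [avL_iff]
      intro i j k hij hjk hk hh
      have hk' : k < m := by omega
      refine hav ⟨⟨i + 2, by omega⟩, ⟨j + 2, by omega⟩, ⟨k + 2, by omega⟩, ?_, ?_, ?_⟩
      · simp [Fin.lt_def, hij]
      · simp [Fin.lt_def, hjk]
      · simpa [l] using hh
  · have hlen : (build m n ((σ i0).val - (n - 3), (σ i1).val - (n - 3), (σ il).val - (n - 3))
        l).length = n := by
      simp only [build, List.length_cons, List.length_append, List.length_range', List.length_nil]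
      omega
    refine List.ext_getElem (by rw [hlen]; simp [toL]) ?_
    intro i hi1 hi2
    rw [build_get m n hn _ l hll i hi1]
    rw [hlen] at hi1
    have e : (toL σ)[i] = (σ ⟨i, hi1⟩).val := by simp [toL]
    rw [e]
    simp only
    split_ifs with c1 c2 c3 c4
    · subst c1
      change _ = (σ i0).val
      omega
    · subst c2
      change _ = (σ i1).val
      omega
    · have : (⟨i, hi1⟩ : Fin n) = ⟨i - 2 + 2, by omega⟩ := by ext; simp only; omega
      rw [this]
      simp [l]
    · have := V ⟨i, hi1⟩ (by simp only; omega) c4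
      simp only at this
      omega
    · have : (⟨i, hi1⟩ : Fin n) = il := by ext; simp only [il]; omega
      rw [this]
      omega

lemma build_inj (m n : ℕ) (t t' : ℕ × ℕ × ℕ) (l l' : List ℕ)
    (hl : l.length = m) (hl' : l'.length = m) (h : build m n t l = build m n t' l') :
    t = t' ∧ l = l' := by
  simp only [build, List.cons.injEq] at h
  obtain ⟨h1, h2, h3⟩ := h
  obtain ⟨e1, e2⟩ := List.append_inj h3 (by omega)
  have e3 := List.append_cancel_left e2
  simp only [List.cons.injEq, and_true] at e3
  refine ⟨?_, e1⟩
  ext <;> omega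

lemma card_top (m n : ℕ) (hm : 1 ≤ m) (hn : 4 + m ≤ n) :
    ((Av132 n).filter (fun σ => mmp 1 2 m 0 σ = n - 3 - m)).card = 5 * catalan m := by
  have h5 : Trip.card = 5 := by decide
  rw [← card_AvF, ← h5, ← Finset.card_product]
  rw [← Finset.card_image_of_injective _ toL_inj]
  symm
  refine Finset.card_bij (fun q _ => build m n q.1 q.2) ?_ ?_ ?_
  · rintro ⟨⟨a, b, c⟩, l⟩ h
    rw [Finset.mem_product] at h
    obtain ⟨b1, b2, b3⟩ := nodup_build m n hn a b c h.1 l h.2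
    obtain ⟨σ, hσ⟩ := toL_surj _ b1 b2 b3
    rw [Finset.mem_image]
    refine ⟨σ, ?_, hσ⟩
    rw [Finset.mem_filter, Av132, Finset.mem_filter, mmp_eq_iff m n hn]
    refine ⟨⟨Finset.mem_univ _, ?_⟩, ?_⟩
    · rw [← avL_toL, hσ]
      exact avL_build m n hn a b c h.1 l h.2
    · exact matches_build m n hn _ l h.2 σ hσ
  · rintro ⟨t, l⟩ h ⟨t', l'⟩ h' e
    rw [Finset.mem_product, mem_AvF] at h h'
    obtain ⟨rfl, rfl⟩ := build_inj m n t t' l l' h.2.1.2.2 h'.2.1.2.2 e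
    rfl
  · intro l hl
    rw [Finset.mem_image] at hl
    obtain ⟨σ, hσ, rfl⟩ := hl
    rw [Finset.mem_filter, Av132, Finset.mem_filter, mmp_eq_iff m n hn] at hσ
    obtain ⟨t, ht, l, hl, e⟩ := exists_build m n hm hn σ hσ.1.2 hσ.2
    exact ⟨(t, l), Finset.mem_product.2 ⟨ht, hl⟩, e⟩

lemma coeff_Q (n a b c d r : ℕ) :
    (Q n a b c d).coeff r = (((Av132 n).filter (fun σ => mmp a b c d σ = r)).card : ℤ) := by
  simp only [Q, Polynomial.finsetSum_coeff, Polynomial.coeff_X_pow, Finset.card_filter,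
    Nat.cast_sum, Nat.cast_ite, Nat.cast_one, Nat.cast_zero, eq_comm]

/-- for `m ≥ 1` and `n ≥ 4 + m`, the highest power of `x` in
`Q_{n,132}^{(1,2,m,0)}(x)` is `x^{n-3-m}`, with coefficient `5·C_m`. -/
theorem stmt6 (m n : ℕ) (hm : 1 ≤ m) (hn : 4 + m ≤ n) :
    (Q n 1 2 m 0).coeff (n - 3 - m) = (5 * catalan m : ℤ) ∧
    ∀ r : ℕ, n - 3 - m < r → (Q n 1 2 m 0).coeff r = 0 := by
  constructor
  · rw [coeff_Q, card_top m n hm hn]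
    push_cast
    rfl
  · intro r hr
    rw [coeff_Q, Finset.filter_false_of_mem]
    · simp
    · intro σ _ h
      have := mmp_le m n hn σ
      omega
end

section
/- For all m ≥ 1 and all n ≥ 5 + m, the highest power of x that occurs in the polynomial Q_{n,132}^{(2,2,m,0)}(x) is x^{n-4-m}, and its coefficient equals 9·C_m; that is, the coefficient of x^{n-4-m} in Q_{n,132}^{(2,2,m,0)}(x) is 9·C_m and the coefficient of x^r is 0 for every r > n-4-m. -/
open Finset Polynomial

namespace MMPaux

/-- 132-avoidance for lists. -/
def LAv : List ℕ → Prop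
  | [] => True
  | a :: l => l.Pairwise (fun b c => ¬ (a < c ∧ c < b)) ∧ LAv l

theorem LAv_append (L R : List ℕ) : LAv (L ++ R) ↔ LAv L ∧ LAv R ∧
    (∀ a ∈ L, R.Pairwise (fun b c => ¬ (a < c ∧ c < b))) ∧
    (∀ c ∈ R, L.Pairwise (fun a b => ¬ (a < c ∧ c < b))) := by
  induction L with
  | nil => simp [LAv]
  | cons x L ih =>
    simp only [List.cons_append, LAv, ih, List.pairwise_append, List.pairwise_cons, List.mem_cons,
      forall_eq_or_imp]
    constructor
    · rintro ⟨⟨h1, h2, h3⟩, h4, h5, h6, h7⟩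
      exact ⟨⟨h1, h4⟩, h5, ⟨h2, h6⟩, fun c hc => ⟨fun b hb => h3 b hb c hc, h7 c hc⟩⟩
    · rintro ⟨⟨h1, h4⟩, h5, ⟨h2, h6⟩, h7⟩
      exact ⟨⟨h1, h2, fun b hb c hc => (h7 c hc).1 b hb⟩, h4, h5, h6, fun c hc => (h7 c hc).2⟩

theorem LAv_iff (l : List ℕ) : LAv l ↔ ∀ i j k (_ : i < j) (_ : j < k) (_ : k < l.length),
    ¬ (l[i] < l[k] ∧ l[k] < l[j]) := by
  induction l with
  | nil => simp [LAv]
  | cons x l ih =>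
    simp only [LAv, ih, List.pairwise_iff_getElem]
    constructor
    · rintro ⟨h1, h2⟩ i j k hij hjk hk
      obtain ⟨j, rfl⟩ : ∃ j', j = j' + 1 := ⟨j - 1, by omega⟩
      obtain ⟨k, rfl⟩ : ∃ k', k = k' + 1 := ⟨k - 1, by omega⟩
      simp only [List.length_cons] at hk
      rcases i with _ | i
      · simpa using h1 j k (by omega) (by omega) (by omega)
      · simpa using h2 i j k (by omega) (by omega) (by omega)
    · intro h
      refine ⟨fun i j hi hj hij => ?_, fun i j k hij hjk hk => ?_⟩
      · exact h 0 (i+1) (j+1) (by omega) (by omega) (by simp; omega)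
      · exact h (i+1) (j+1) (k+1) (by omega) (by omega) (by simp; omega)

theorem LAv_of_sorted {l : List ℕ} (h : l.Pairwise (· ≤ ·)) : LAv l := by
  induction l with
  | nil => trivial
  | cons a l ih =>
    rw [List.pairwise_cons] at h
    exact ⟨h.2.imp (by intros; omega), ih h.2⟩

theorem range'_sorted (s n : ℕ) : (List.range' s n).Pairwise (· ≤ ·) := by
  have := List.pairwise_lt_range' (s := s) (n := n) (step := 1)
  exact this.imp (fun h => h.le)

theorem split_perm {A B : List ℕ} {off k : ℕ} (h : (A ++ B).Perm (List.range' off k))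
    (hAB : ∀ a ∈ A, ∀ b ∈ B, a ≤ b) :
    A.Perm (List.range' off A.length) ∧ B.Perm (List.range' (off + A.length) B.length) := by
  have hk : A.length + B.length = k := by simpa using h.length_eq
  have pA := List.perm_insertionSort (· ≤ ·) A
  have pB := List.perm_insertionSort (· ≤ ·) B
  have h1 : (A.insertionSort (· ≤ ·) ++ B.insertionSort (· ≤ ·)).Perm (List.range' off k) :=
    (pA.append pB).trans h
  have h2 := h1.eq_of_pairwise' (r := (· ≤ ·)) (by
    rw [List.pairwise_append]
    refine ⟨List.pairwise_insertionSort _ _, List.pairwise_insertionSort _ _, fun a ha b hb => ?_⟩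
    exact hAB a (pA.mem_iff.1 ha) b (pB.mem_iff.1 hb)) (range'_sorted _ _)
  rw [← hk, ← List.range'_append_1] at h2
  obtain ⟨e1, e2⟩ := List.append_inj h2 (by simp)
  exact ⟨e1 ▸ pA.symm, e2 ▸ pB.symm⟩

/-- The list of a binary tree. -/
def tl : BinaryTree Unit → ℕ → List ℕ
  | .nil, _ => []
  | .node _ l r, off => tl l (off + r.numNodes) ++ (off + (l.numNodes + r.numNodes)) :: tl r off

theorem tl_perm (t : BinaryTree Unit) (off : ℕ) : (tl t off).Perm (List.range' off t.numNodes) := by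
  induction t generalizing off with
  | nil => simp [tl]
  | node v l r hl hr =>
    simp only [tl, BinaryTree.numNodes]
    refine List.perm_middle.trans ?_
    rw [List.range'_concat, one_mul]
    refine List.Perm.trans ?_ (List.perm_append_singleton _ _).symm
    refine List.Perm.cons _ ?_
    refine List.perm_append_comm.trans ?_
    rw [add_comm l.numNodes, ← List.range'_append_1]
    exact (hr _).append (hl _)

theorem tl_mem {t : BinaryTree Unit} {off a : ℕ} : a ∈ tl t off ↔ off ≤ a ∧ a < off + t.numNodes := by
  rw [(tl_perm t off).mem_iff]; simp

theorem tl_length (t : BinaryTree Unit) (off : ℕ) : (tl t off).length = t.numNodes := by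
  simpa using (tl_perm t off).length_eq

theorem pairwise_of_forall {l : List ℕ} {R : ℕ → ℕ → Prop} (h : ∀ a ∈ l, ∀ b ∈ l, R a b) :
    l.Pairwise R := by
  induction l with
  | nil => exact List.Pairwise.nil
  | cons x l ih =>
    rw [List.pairwise_cons]
    exact ⟨fun b hb => h _ (by simp) _ (by simp [hb]),
      ih fun a ha b hb => h _ (by simp [ha]) _ (by simp [hb])⟩

theorem tl_av (t : BinaryTree Unit) (off : ℕ) : LAv (tl t off) := by
  induction t generalizing off with
  | nil => simp [tl, LAv]
  | node v l r hl hr =>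
    simp only [tl, LAv_append, LAv]
    refine ⟨hl _, ⟨?_, hr _⟩, ?_, ?_⟩
    · apply pairwise_of_forall
      intro a ha b hb
      rw [tl_mem] at *
      omega
    · intro a ha
      apply pairwise_of_forall
      intro b hb c hc
      simp only [List.mem_cons, tl_mem] at *
      omega
    · intro c hc
      apply pairwise_of_forall
      intro a ha b hb
      simp only [List.mem_cons, tl_mem] at *
      omega

theorem tl_surj (n off : ℕ) (l : List ℕ) (h : l.Perm (List.range' off n)) (hl : LAv l) :
    ∃ t : BinaryTree Unit, t.numNodes = n ∧ tl t off = l := by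
  induction n using Nat.strong_induction_on generalizing off l with
  | _ n ih =>
  rcases n with _ | n
  · refine ⟨.nil, rfl, ?_⟩
    simp at h
    simp [tl, h]
  · have hmem : off + n ∈ l := by rw [h.mem_iff]; simp
    obtain ⟨L, R, rfl⟩ := List.append_of_mem hmem
    have hnd : (L ++ (off + n) :: R).Nodup := h.nodup_iff.2 List.nodup_range'
    have hmm : ∀ x ∈ L ++ (off + n) :: R, off ≤ x ∧ x ≤ off + n := by
      intro x hx; rw [h.mem_iff] at hx; simp at hx; omega
    rw [LAv_append] at hl
    obtain ⟨aL, ⟨aR1, aR⟩, h3, -⟩ := hl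
    have hRL : ∀ a ∈ R, ∀ b ∈ L, a ≤ b := by
      intro a ha b hb
      have := List.rel_of_pairwise_cons (h3 b hb) ha
      have h5 : a ≠ off + n := by
        rintro rfl
        simp [List.nodup_append, List.nodup_cons] at hnd
        tauto
      have := hmm a (by simp [ha])
      omega
    have hp : (R ++ L).Perm (List.range' off n) := by
      have h1 : ((off + n) :: (L ++ R)).Perm ((off + n) :: List.range' off n) := by
        refine List.perm_middle.symm.trans (h.trans ?_)
        rw [List.range'_concat, one_mul]
        exact List.perm_append_singleton _ _
      exact List.perm_append_comm.trans (List.perm_cons _ |>.1 h1)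
    have hlen : R.length + L.length = n := by simpa using hp.length_eq
    obtain ⟨pR, pL⟩ := split_perm hp hRL
    obtain ⟨tR, e1, e2⟩ := ih R.length (by omega) _ _ pR aR
    obtain ⟨tL, e3, e4⟩ := ih L.length (by omega) _ _ pL aL
    refine ⟨.node () tL tR, ?_, ?_⟩
    · simp; omega
    · simp only [tl, e1, e2, e3, e4]
      rw [show L.length + R.length = n by omega]

theorem tl_inj (t t' : BinaryTree Unit) (off : ℕ) (h : tl t off = tl t' off) : t = t' := by
  induction t generalizing off t' with
  | nil =>
    cases t' with
    | nil => rfl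
    | node v l r => simp [tl] at h
  | node v l r hl hr =>
    cases t' with
    | nil => simp [tl] at h
    | node v' l' r' =>
      have hlen := congrArg List.length h
      rw [tl_length, tl_length] at hlen
      simp only [BinaryTree.numNodes] at hlen
      simp only [tl] at h
      rw [show l'.numNodes + r'.numNodes = l.numNodes + r.numNodes by omega] at h
      obtain ⟨h1, h2⟩ : tl l (off + r.numNodes) = tl l' (off + r'.numNodes) ∧ tl r off = tl r' off := by
        rw [List.append_eq_append_iff] at h
        rcases h with ⟨as, h1, h2⟩ | ⟨as, h1, h2⟩
        · rcases as with _ | ⟨a, as⟩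
          · simp at h1 h2; exact ⟨h1.symm, h2⟩
          · exfalso
            simp at h2
            have : a ∈ tl l' (off + r'.numNodes) := by rw [h1]; simp
            rw [tl_mem] at this
            omega
        · rcases as with _ | ⟨a, as⟩
          · simp at h1 h2; exact ⟨h1, h2.symm⟩
          · exfalso
            simp at h2
            have : a ∈ tl l (off + r.numNodes) := by rw [h1]; simp
            rw [tl_mem] at this
            omega
      have e2 := hr _ _ h2
      subst e2
      rw [hl _ _ h1]

/-- All 132-avoiding lists on `0..m-1`. -/
def TL (m : ℕ) : Finset (List ℕ) := (BinaryTree.treesOfNumNodesEq m).image (fun t => tl t 0)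

theorem card_TL (m : ℕ) : (TL m).card = catalan m := by
  rw [TL, Finset.card_image_of_injective _ (fun a b h => tl_inj a b 0 h),
    BinaryTree.treesOfNumNodesEq_card_eq_catalan]

theorem mem_TL {m : ℕ} {l : List ℕ} : l ∈ TL m ↔ l.Perm (List.range m) ∧ LAv l := by
  simp only [TL, Finset.mem_image, BinaryTree.mem_treesOfNumNodesEq]
  constructor
  · rintro ⟨t, rfl, rfl⟩
    exact ⟨by simpa [List.range_eq_range'] using tl_perm t 0, tl_av _ _⟩
  · rintro ⟨h1, h2⟩
    rw [List.range_eq_range'] at h1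
    exact tl_surj _ _ _ h1 h2

/-- The values of a permutation, as a function on the naturals. -/
def sv {n : ℕ} (σ : Equiv.Perm (Fin n)) (i : ℕ) : ℕ := if h : i < n then σ ⟨i, h⟩ else 0

theorem sv_eq {n : ℕ} (σ : Equiv.Perm (Fin n)) {i : ℕ} (h : i < n) : sv σ i = σ ⟨i, h⟩ := by
  simp [sv, h]

theorem sv_val {n : ℕ} (σ : Equiv.Perm (Fin n)) (i : Fin n) : sv σ i = σ i := by
  simp [sv]

theorem sv_lt {n : ℕ} (σ : Equiv.Perm (Fin n)) {i : ℕ} (h : i < n) : sv σ i < n := by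
  simp [sv, h]

theorem sv_inj {n : ℕ} (σ : Equiv.Perm (Fin n)) {i j : ℕ} (hi : i < n) (hj : j < n)
    (h : sv σ i = sv σ j) : i = j := by
  rw [sv_eq σ hi, sv_eq σ hj] at h
  have := σ.injective (Fin.ext h)
  simpa using this

/-- The word of a permutation. -/
def toL {n : ℕ} (σ : Equiv.Perm (Fin n)) : List ℕ := (List.range n).map (sv σ)

theorem toL_inj {n : ℕ} (σ τ : Equiv.Perm (Fin n)) (h : toL σ = toL τ) : σ = τ := by
  ext i
  rw [toL, toL, List.map_inj_left] at h
  have := h i (by simp)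
  rwa [sv_val, sv_val] at this

theorem perm_range_of {n : ℕ} {l : List ℕ} (h1 : l.Nodup) (h2 : ∀ x ∈ l, x < n)
    (h3 : l.length = n) : l.Perm (List.range n) := by
  apply List.Subperm.perm_of_length_le
  · apply h1.subperm
    intro x hx; simpa using h2 x hx
  · simp [h3]

theorem toL_perm {n : ℕ} (σ : Equiv.Perm (Fin n)) : (toL σ).Perm (List.range n) := by
  apply perm_range_of
  · apply List.Nodup.map_on _ List.nodup_range
    intro x hx y hy h
    simp at hx hy
    exact sv_inj σ hx hy h
  · intro x hx
    simp [toL] at hx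
    obtain ⟨a, ha, rfl⟩ := hx
    exact sv_lt σ ha
  · simp [toL]

theorem toL_surj {n : ℕ} (l : List ℕ) (h : l.Perm (List.range n)) :
    ∃ σ : Equiv.Perm (Fin n), toL σ = l := by
  have hlen : l.length = n := by simpa using h.length_eq
  have hnd : l.Nodup := h.nodup_iff.2 List.nodup_range
  have hlt : ∀ x ∈ l, x < n := fun x hx => by simpa using h.mem_iff.1 hx
  let f : Fin n → Fin n := fun i => ⟨l[(i : ℕ)]'(by omega), hlt _ (List.getElem_mem _)⟩
  have hf : Function.Injective f := by
    intro i j hij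
    simp only [f, Fin.mk.injEq] at hij
    exact Fin.ext ((hnd.getElem_inj_iff).1 hij)
  refine ⟨Equiv.ofBijective f (Finite.injective_iff_bijective.1 hf), ?_⟩
  apply List.ext_getElem
  · simp [toL, hlen]
  · intro i h1 h2
    have hi : i < n := by omega
    simp [toL, sv, f, hi]

theorem toL_av {n : ℕ} (σ : Equiv.Perm (Fin n)) : LAv (toL σ) ↔ Avoids132 σ := by
  rw [LAv_iff, Avoids132]
  simp only [toL, List.length_map, List.length_range, List.getElem_map, List.getElem_range]
  constructor
  · rintro h ⟨i, j, k, hij, hjk, h1, h2⟩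
    apply h i j k hij hjk k.2
    simp only [sv_val]
    exact ⟨h1, h2⟩
  · rintro h i j k hij hjk hk ⟨h1, h2⟩
    rw [sv_eq σ (show i < n by omega), sv_eq σ hk] at h1
    rw [sv_eq σ (show j < n by omega), sv_eq σ hk] at h2
    exact h ⟨⟨i, by omega⟩, ⟨j, by omega⟩, ⟨k, hk⟩, hij, hjk, h1, h2⟩

theorem av_nat {n : ℕ} {σ : Equiv.Perm (Fin n)} (h : Avoids132 σ) {i j k : ℕ} (hij : i < j)
    (hjk : j < k) (hk : k < n) (h1 : sv σ i < sv σ k) (h2 : sv σ k < sv σ j) : False := by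
  rw [← toL_av, LAv_iff] at h
  have := h i j k hij hjk (by simpa [toL] using hk)
  simp only [toL, List.getElem_map, List.getElem_range] at this
  exact this ⟨h1, h2⟩

theorem card_left {n : ℕ} (σ : Equiv.Perm (Fin n)) (i : Fin n) :
    (Finset.univ.filter (fun j => j < i ∧ σ i < σ j)).card +
    (Finset.univ.filter (fun j => j < i ∧ σ j < σ i)).card = i := by
  rw [← Finset.card_union_of_disjoint]
  · rw [← Fin.card_Iio i]
    congr 1
    ext j
    simp only [Finset.mem_union, Finset.mem_filter, Finset.mem_univ, true_and, Finset.mem_Iio]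
    constructor
    · rintro (h | h) <;> exact h.1
    · intro h
      have : σ i ≠ σ j := fun e => h.ne (σ.injective e).symm
      rcases lt_or_gt_of_ne this with h' | h'
      · exact Or.inl ⟨h, h'⟩
      · exact Or.inr ⟨h, h'⟩
  · rw [Finset.disjoint_filter]
    rintro x - ⟨-, h⟩ ⟨-, h'⟩
    exact lt_asymm h h'

theorem match_bounds {n m : ℕ} {σ : Equiv.Perm (Fin n)} {i : Fin n} (h : MatchesMMP 2 2 m 0 σ i) :
    m + 2 ≤ (i : ℕ) ∧ (i : ℕ) + 2 < n := by
  obtain ⟨h1, h2, h3, -⟩ := h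
  have := card_left σ i
  refine ⟨by omega, ?_⟩
  have : (Finset.univ.filter (fun j => i < j ∧ σ i < σ j)).card ≤ (Finset.Ioi i).card := by
    apply Finset.card_le_card
    intro j
    simp only [Finset.mem_filter, Finset.mem_univ, true_and, Finset.mem_Ioi]
    exact fun h => h.1
  rw [Fin.card_Ioi] at this
  omega

theorem match_subset {n m : ℕ} (hn : 5 + m ≤ n) (σ : Equiv.Perm (Fin n)) :
    Finset.univ.filter (MatchesMMP 2 2 m 0 σ) ⊆
      Finset.Icc (⟨m + 2, by omega⟩ : Fin n) ⟨n - 3, by omega⟩ := by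
  intro i hi
  have := match_bounds (Finset.mem_filter.1 hi).2
  rw [Finset.mem_Icc, Fin.le_def, Fin.le_def]
  simp only
  omega

theorem card_mid {n m : ℕ} (hn : 5 + m ≤ n) :
    (Finset.Icc (⟨m + 2, by omega⟩ : Fin n) ⟨n - 3, by omega⟩).card = n - 4 - m := by
  rw [Fin.card_Icc]
  simp only
  omega

theorem mmp_le {n m : ℕ} (hn : 5 + m ≤ n) (σ : Equiv.Perm (Fin n)) :
    mmp 2 2 m 0 σ ≤ n - 4 - m := by
  rw [← card_mid hn]
  exact Finset.card_le_card (match_subset hn σ)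

theorem mmp_eq_iff {n m : ℕ} (hn : 5 + m ≤ n) (σ : Equiv.Perm (Fin n)) :
    mmp 2 2 m 0 σ = n - 4 - m ↔ ∀ i : Fin n, m + 2 ≤ (i : ℕ) → (i : ℕ) + 2 < n →
      MatchesMMP 2 2 m 0 σ i := by
  constructor
  · intro h i h1 h2
    have := Finset.eq_of_subset_of_card_le (match_subset hn σ) (by rw [card_mid hn, ← h]; rfl)
    have hi : i ∈ Finset.Icc (⟨m + 2, by omega⟩ : Fin n) ⟨n - 3, by omega⟩ := by
      rw [Finset.mem_Icc, Fin.le_def, Fin.le_def]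
      simp only
      omega
    rw [← this] at hi
    exact (Finset.mem_filter.1 hi).2
  · intro h
    refine le_antisymm (mmp_le hn σ) ?_
    rw [← card_mid hn]
    apply Finset.card_le_card
    intro i hi
    rw [Finset.mem_Icc, Fin.le_def, Fin.le_def] at hi
    simp only at hi
    exact Finset.mem_filter.2 ⟨Finset.mem_univ _, h i (by omega) (by omega)⟩

/-- The shape of the extremal permutations. -/
def Shape (m n : ℕ) (s : ℕ → ℕ) : Prop :=
  (∀ i j, m + 2 ≤ i → i < j → j < n → s i < s j) ∧ (∀ i, 2 ≤ i → i < m + 2 → s i < s (m + 2)) ∧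
    s (n - 3) < s 0 ∧ s (n - 3) < s 1

theorem mmp_of_shape {n m : ℕ} (hn : 5 + m ≤ n) (σ : Equiv.Perm (Fin n)) (h : Shape m n (sv σ)) :
    mmp 2 2 m 0 σ = n - 4 - m := by
  rw [mmp_eq_iff hn]
  intro i h1 h2
  obtain ⟨hA, hB, h0, h1'⟩ := h
  have key : ∀ {a b : ℕ} (ha : a < n) (hb : b < n), sv σ a < sv σ b → σ ⟨a, ha⟩ < σ ⟨b, hb⟩ := by
    intro a b ha hb h
    rwa [sv_eq σ ha, sv_eq σ hb] at h
  obtain ⟨i, hi⟩ := i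
  simp only at h1 h2
  have hle : sv σ i ≤ sv σ (n - 3) := by
    rcases Nat.lt_or_ge i (n - 3) with h | h
    · exact (hA i (n - 3) h1 h (by omega)).le
    · rw [show i = n - 3 by omega]
  have hle' : sv σ (m + 2) ≤ sv σ i := by
    rcases Nat.lt_or_ge (m + 2) i with h | h
    · exact (hA (m + 2) i le_rfl h (by omega)).le
    · rw [show i = m + 2 by omega]
  refine ⟨?_, ?_, ?_, Nat.zero_le _⟩
  · rw [Nat.succ_le_iff, Finset.one_lt_card]
    refine ⟨⟨n - 2, by omega⟩, ?_, ⟨n - 1, by omega⟩, ?_, ?_⟩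
    · simp only [Finset.mem_filter, Finset.mem_univ, true_and]
      exact ⟨by rw [Fin.lt_def]; simp only; omega, key _ _ (hA _ _ h1 (by omega) (by omega))⟩
    · simp only [Finset.mem_filter, Finset.mem_univ, true_and]
      exact ⟨by rw [Fin.lt_def]; simp only; omega, key _ _ (hA _ _ h1 (by omega) (by omega))⟩
    · simp only [ne_eq, Fin.mk.injEq]; omega
  · rw [Nat.succ_le_iff, Finset.one_lt_card]
    refine ⟨⟨0, by omega⟩, ?_, ⟨1, by omega⟩, ?_, ?_⟩
    · simp only [Finset.mem_filter, Finset.mem_univ, true_and]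
      exact ⟨by rw [Fin.lt_def]; simp only; omega, key _ _ (by omega)⟩
    · simp only [Finset.mem_filter, Finset.mem_univ, true_and]
      exact ⟨by rw [Fin.lt_def]; simp only; omega, key _ _ (by omega)⟩
    · simp only [ne_eq, Fin.mk.injEq]; omega
  · have hc : (Finset.Ico (⟨2, by omega⟩ : Fin n) ⟨m + 2, by omega⟩).card = m := by
      rw [Fin.card_Ico]; simp
    calc m = _ := hc.symm
      _ ≤ _ := ?_
    apply Finset.card_le_card
    rintro ⟨j, hj⟩ hj'
    rw [Finset.mem_Ico, Fin.le_def, Fin.lt_def] at hj'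
    simp only at hj'
    simp only [Finset.mem_filter, Finset.mem_univ, true_and]
    refine ⟨by rw [Fin.lt_def]; simp only; omega, key _ _ ?_⟩
    have := hB j (by omega) (by omega)
    omega

theorem shape_of_mmp {n m : ℕ} (hm : 1 ≤ m) (hn : 5 + m ≤ n) (σ : Equiv.Perm (Fin n))
    (hav : Avoids132 σ) (h : mmp 2 2 m 0 σ = n - 4 - m) : Shape m n (sv σ) := by
  rw [mmp_eq_iff hn] at h
  have key : ∀ {a b : Fin n}, σ a < σ b → sv σ a < sv σ b := by
    intro a b h
    rwa [sv_val, sv_val]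
  -- the last two entries
  have hlast : sv σ (n - 3) < sv σ (n - 2) ∧ sv σ (n - 3) < sv σ (n - 1) := by
    have h1 := (h ⟨n - 3, by omega⟩ (by simp only; omega) (by simp only; omega)).1
    rw [Nat.succ_le_iff, Finset.one_lt_card] at h1
    obtain ⟨⟨a, ha⟩, ha', ⟨b, hb⟩, hb', hab⟩ := h1
    simp only [Finset.mem_filter, Finset.mem_univ, true_and, Fin.lt_def] at ha' hb'
    simp only [ne_eq, Fin.mk.injEq] at hab
    have ea : sv σ (n - 3) < sv σ a := key (a := ⟨n - 3, by omega⟩) (b := ⟨a, ha⟩) ha'.2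
    have eb : sv σ (n - 3) < sv σ b := key (a := ⟨n - 3, by omega⟩) (b := ⟨b, hb⟩) hb'.2
    rcases (show (a = n - 2 ∧ b = n - 1) ∨ (a = n - 1 ∧ b = n - 2) by omega) with ⟨rfl, rfl⟩ | ⟨rfl, rfl⟩
    · exact ⟨ea, eb⟩
    · exact ⟨eb, ea⟩
  -- no descents into matching positions
  have hstep : ∀ i, m + 2 ≤ i → i + 2 < n → sv σ (i - 1) < sv σ i := by
    intro i h1 h2
    have h3 := (h ⟨i, by omega⟩ h1 h2).2.2.1
    obtain ⟨⟨j, hj⟩, hj'⟩ := Finset.card_pos.1 (lt_of_lt_of_le hm h3)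
    simp only [Finset.mem_filter, Finset.mem_univ, true_and, Fin.lt_def] at hj'
    have ej : sv σ j < sv σ i := key (a := ⟨j, hj⟩) (b := ⟨i, by omega⟩) hj'.2
    rcases Nat.lt_or_ge j (i - 1) with hlt | hge
    · by_contra hcon
      have hne : sv σ (i - 1) ≠ sv σ i := fun e => by
        have := sv_inj σ (by omega) (by omega) e
        omega
      exact av_nat hav hlt (show i - 1 < i by omega) (by omega) ej (by omega)
    · rwa [show i - 1 = j by omega]
  have hstep2 : ∀ i, m + 2 ≤ i → i < n → sv σ (i - 1) < sv σ i := by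
    intro i h1 h2
    rcases Nat.lt_or_ge (i + 2) n with h3 | h3
    · exact hstep i h1 h3
    · rcases (show i = n - 2 ∨ i = n - 1 by omega) with rfl | rfl
      · rw [show n - 2 - 1 = n - 3 by omega]; exact hlast.1
      · rw [show n - 1 - 1 = n - 2 by omega]
        by_contra hcon
        have hne : sv σ (n - 2) ≠ sv σ (n - 1) := fun e => by
          have := sv_inj σ (by omega) (by omega) e
          omega
        exact av_nat hav (show n - 3 < n - 2 by omega) (show n - 2 < n - 1 by omega) (by omega)
          hlast.2 (by omega)
  have hmono : ∀ i j, m + 2 ≤ i → i < j → j < n → sv σ i < sv σ j := by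
    intro i j h1 h2 h3
    induction j, h2 using Nat.le_induction with
    | base => exact hstep2 (i + 1) (by omega) h3
    | succ j hj ih => exact (ih (by omega)).trans (hstep2 (j + 1) (by omega) h3)
  have hle' : sv σ (m + 2) ≤ sv σ (n - 3) := by
    rcases Nat.lt_or_ge (m + 2) (n - 3) with h | h
    · exact (hmono (m + 2) (n - 3) le_rfl h (by omega)).le
    · rw [show n - 3 = m + 2 by omega]
  -- the larger entries to the left
  set f : Fin n := ⟨m + 2, by omega⟩ with hf
  set g : Fin n := ⟨n - 3, by omega⟩ with hg
  have mf := h f le_rfl (by simp only [hf]; omega)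
  have mg := h g (by simp only [hg]; omega) (by simp only [hg]; omega)
  set Bf := Finset.univ.filter (fun j => j < f ∧ σ f < σ j) with hBf
  set Bg := Finset.univ.filter (fun j => j < g ∧ σ g < σ j) with hBg
  have cf : Bf.card = 2 := by
    have h1 := card_left σ f
    have h2 := mf.2.1
    have h3 := mf.2.2.1
    have h4 : (f : ℕ) = m + 2 := rfl
    rw [← hBf] at h1 h2
    omega
  have hsub : Bg ⊆ Bf := by
    rintro ⟨j, hj⟩ hj'
    simp only [hBg, hBf, Finset.mem_filter, Finset.mem_univ, true_and, Fin.lt_def, hf, hg] at hj' ⊢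
    have ej : sv σ (n - 3) < sv σ j := key (a := g) (b := ⟨j, hj⟩) hj'.2
    have hjlt : j < m + 2 := by
      by_contra hcon
      have := hmono j (n - 3) (by omega) hj'.1 (by omega)
      omega
    refine ⟨hjlt, ?_⟩
    have : sv σ (m + 2) < sv σ j := by omega
    rwa [sv_eq σ (show m + 2 < n by omega), sv_eq σ hj] at this
  have heq : Bg = Bf := Finset.eq_of_subset_of_card_le hsub (by rw [cf]; exact mg.2.1)
  have memBf : ∀ j (hj : j < n), (⟨j, hj⟩ : Fin n) ∈ Bf ↔ j < m + 2 ∧ sv σ (m + 2) < sv σ j := by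
    intro j hj
    rw [sv_eq σ (show m + 2 < n by omega), sv_eq σ hj]
    simp only [hBf, Finset.mem_filter, Finset.mem_univ, true_and, Fin.lt_def, hf]
  have memBg : ∀ j (hj : j < n), (⟨j, hj⟩ : Fin n) ∈ Bg ↔ j < n - 3 ∧ sv σ (n - 3) < sv σ j := by
    intro j hj
    rw [sv_eq σ (show n - 3 < n by omega), sv_eq σ hj]
    simp only [hBg, Finset.mem_filter, Finset.mem_univ, true_and, Fin.lt_def, hg]
  have hdown : ∀ i j (hi : i < n) (hj : j < n), i < j → (⟨j, hj⟩ : Fin n) ∈ Bf →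
      (⟨i, hi⟩ : Fin n) ∈ Bf := by
    intro i j hi hj hij hmem
    rw [memBf] at hmem ⊢
    refine ⟨by omega, ?_⟩
    by_contra hcon
    have hne : sv σ i ≠ sv σ (m + 2) := fun e => by
      have := sv_inj σ (by omega) (by omega) e
      omega
    exact av_nat hav hij hmem.1 (by omega) (by omega) hmem.2
  have h1mem : (⟨1, by omega⟩ : Fin n) ∈ Bf := by
    have : 1 < Bf.card := by omega
    rw [Finset.one_lt_card] at this
    obtain ⟨⟨a, ha⟩, ha', ⟨b, hb⟩, hb', hab⟩ := this
    simp only [ne_eq, Fin.mk.injEq] at hab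
    by_cases ha1 : a = 1
    · subst ha1; exact ha'
    by_cases hb1 : b = 1
    · subst hb1; exact hb'
    rcases Nat.lt_or_ge 1 a with h | h
    · exact hdown 1 a (by omega) ha h ha'
    · exact hdown 1 b (by omega) hb (by omega) hb'
  have h0mem : (⟨0, by omega⟩ : Fin n) ∈ Bf := hdown 0 1 (by omega) (by omega) (by omega) h1mem
  have hBf2 : ({⟨0, by omega⟩, ⟨1, by omega⟩} : Finset (Fin n)) = Bf := by
    apply Finset.eq_of_subset_of_card_le
    · intro x hx
      simp only [Finset.mem_insert, Finset.mem_singleton] at hx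
      rcases hx with rfl | rfl <;> assumption
    · rw [cf, Finset.card_pair]
      simp
  refine ⟨hmono, ?_, ?_, ?_⟩
  · intro i hi hi'
    by_contra hcon
    have hne : sv σ i ≠ sv σ (m + 2) := fun e => by
      have := sv_inj σ (by omega) (by omega) e
      omega
    have : (⟨i, by omega⟩ : Fin n) ∈ Bf := (memBf _ _).2 ⟨hi', by omega⟩
    rw [← hBf2] at this
    simp only [Finset.mem_insert, Finset.mem_singleton, Fin.mk.injEq] at this
    omega
  · rw [← heq, memBg] at h0mem
    exact h0mem.2
  · rw [← heq, memBg] at h1mem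
    exact h1mem.2

/-- The nine possible patterns of the first two and last two entries. -/
def Sq : Finset (ℕ × ℕ × ℕ × ℕ) :=
  (Finset.range 4 ×ˢ Finset.range 4 ×ˢ Finset.range 4 ×ˢ Finset.range 4).filter
    (fun q => q.1 ≠ q.2.1 ∧ q.1 ≠ q.2.2.1 ∧ q.1 ≠ q.2.2.2 ∧ q.2.1 ≠ q.2.2.1 ∧ q.2.1 ≠ q.2.2.2 ∧
      q.2.2.1 < q.2.2.2 ∧ ¬ (q.1 < q.2.2.1 ∧ q.2.2.1 < q.2.1) ∧
      ¬ (q.1 < q.2.2.2 ∧ q.2.2.2 < q.2.1))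

theorem card_Sq : Sq.card = 9 := by rfl

theorem mem_Sq {x y z w : ℕ} : (x, y, z, w) ∈ Sq ↔ (x < 4 ∧ y < 4 ∧ z < 4 ∧ w < 4) ∧
    x ≠ y ∧ x ≠ z ∧ x ≠ w ∧ y ≠ z ∧ y ≠ w ∧ z < w ∧ ¬ (x < z ∧ z < y) ∧ ¬ (x < w ∧ w < y) := by
  simp only [Sq, Finset.mem_filter, Finset.mem_product, Finset.mem_range]

/-- The extremal list with given parameters. -/
def mk (m n : ℕ) (q : (ℕ × ℕ × ℕ × ℕ) × List ℕ) : List ℕ :=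
  (n - 4 + q.1.1) :: (n - 4 + q.1.2.1) :: (q.2 ++ (List.range' m (n - 4 - m) ++
    [n - 4 + q.1.2.2.1, n - 4 + q.1.2.2.2]))

theorem mk_injOn (m n : ℕ) : Set.InjOn (mk m n) (Sq ×ˢ TL m : Finset _) := by
  rintro ⟨⟨x, y, z, w⟩, τ⟩ h ⟨⟨x', y', z', w'⟩, τ'⟩ h' e
  simp only [Finset.coe_product, Set.mem_prod, Finset.mem_coe, mem_TL] at h h'
  have l1 := h.2.1.length_eq
  have l2 := h'.2.1.length_eq
  simp only [mk, List.cons.injEq] at e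
  obtain ⟨e1, e2, e3⟩ := e
  obtain ⟨e4, e5⟩ := List.append_inj e3 (by omega)
  have e6 := List.append_cancel_left e5
  simp only [List.cons.injEq, and_true] at e6
  simp only [Prod.mk.injEq]
  refine ⟨⟨?_, ?_, ?_, ?_⟩, e4⟩ <;> omega

theorem mk_perm {m n : ℕ} (hn : 5 + m ≤ n) {x y z w : ℕ} {τ : List ℕ} (hq : (x, y, z, w) ∈ Sq)
    (hτ : τ ∈ TL m) : (mk m n ((x, y, z, w), τ)).Perm (List.range n) := by
  rw [mem_Sq] at hq
  rw [mem_TL] at hτ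
  have hnd : τ.Nodup := hτ.1.nodup_iff.2 List.nodup_range
  have hlen : τ.length = m := by simpa using hτ.1.length_eq
  have hlt : ∀ a ∈ τ, a < m := fun a ha => by simpa using hτ.1.mem_iff.1 ha
  apply perm_range_of
  · simp only [mk, List.nodup_cons, List.mem_cons, List.mem_append, List.mem_range'_1,
      List.nodup_append, List.not_mem_nil, or_false, List.nodup_nil, not_false_eq_true, and_true]
    refine ⟨?_, ?_, hnd, ⟨List.nodup_range', ?_, ?_⟩, ?_⟩
    · rintro (h | h | h | h | h)
      · omega
      · have := hlt _ h; omega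
      all_goals omega
    · rintro (h | h | h | h)
      · have := hlt _ h; omega
      all_goals omega
    · omega
    · rintro a ha b (hb | hb) <;> omega
    · rintro a ha b (hb | hb | hb) <;> have := hlt _ ha <;> omega
  · intro a ha
    simp only [mk, List.mem_cons, List.mem_append, List.mem_range'_1, List.not_mem_nil,
      or_false] at ha
    rcases ha with h | h | h | h | h | h
    · omega
    · omega
    · have := hlt _ h; omega
    all_goals omega
  · simp [mk, hlen]; omega

theorem mk_av {m n : ℕ} (hn : 5 + m ≤ n) {x y z w : ℕ} {τ : List ℕ} (hq : (x, y, z, w) ∈ Sq)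
    (hτ : τ ∈ TL m) : LAv (mk m n ((x, y, z, w), τ)) := by
  rw [mem_Sq] at hq
  rw [mem_TL] at hτ
  have hlt : ∀ a ∈ τ, a < m := fun a ha => by simpa using hτ.1.mem_iff.1 ha
  have hsort : (List.range' m (n - 4 - m) ++ [n - 4 + z, n - 4 + w]).Pairwise (· ≤ ·) := by
    rw [List.pairwise_append]
    refine ⟨range'_sorted _ _, ?_, ?_⟩
    · simp; omega
    · intro a ha b hb
      simp only [List.mem_range'_1, List.mem_cons, List.not_mem_nil, or_false] at ha hb
      omega
  have hmem : ∀ a ∈ List.range' m (n - 4 - m) ++ [n - 4 + z, n - 4 + w],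
      m ≤ a ∧ (a < n - 4 ∨ a = n - 4 + z ∨ a = n - 4 + w) := by
    intro a ha
    simp only [List.mem_append, List.mem_range'_1, List.mem_cons, List.not_mem_nil, or_false] at ha
    omega
  simp only [mk, LAv, LAv_append τ]
  have hP : ∀ p, n - 4 ≤ p → (τ ++ (List.range' m (n - 4 - m) ++
      [n - 4 + z, n - 4 + w])).Pairwise (fun b c => ¬ (p < c ∧ c < b)) := by
    intro p hp
    rw [List.pairwise_append]
    refine ⟨?_, hsort.imp (by intros; omega), ?_⟩
    · apply pairwise_of_forall
      intro a ha b hb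
      have := hlt b hb
      omega
    · intro a ha b hb
      have := hlt a ha
      have := hmem b hb
      omega
  refine ⟨?_, hP _ (by omega), hτ.2, LAv_of_sorted hsort, ?_, ?_⟩
  · rw [List.pairwise_cons]
    refine ⟨?_, hP _ (by omega)⟩
    intro c hc
    rw [List.mem_append] at hc
    rcases hc with hc | hc
    · have := hlt c hc; omega
    · have := hmem c hc; omega
  · intro a ha
    exact hsort.imp (by intros; omega)
  · intro c hc
    have := hmem c hc
    apply pairwise_of_forall
    intro a ha b hb
    have := hlt b hb
    omega

theorem toL_split {n m : ℕ} (hn : 5 + m ≤ n) (σ : Equiv.Perm (Fin n)) :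
    toL σ = sv σ 0 :: sv σ 1 :: ((List.range' 2 m).map (sv σ) ++
      ((List.range' (m + 2) (n - 4 - m)).map (sv σ) ++ [sv σ (n - 2), sv σ (n - 1)])) := by
  have : List.range n = 0 :: 1 :: (List.range' 2 m ++ (List.range' (m + 2) (n - 4 - m) ++
      [n - 2, n - 1])) := by
    obtain ⟨k, rfl⟩ : ∃ k, n = 2 + (m + (k + 2)) := ⟨n - 4 - m, by omega⟩
    rw [show 2 + (m + (k + 2)) - 4 - m = k by omega, List.range_eq_range', ← List.range'_append_1,
      ← List.range'_append_1, ← List.range'_append_1]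
    simp [List.range', add_comm, add_left_comm]
    omega
  rw [toL, this]
  simp

theorem shape_of_mk {m n : ℕ} (hn : 5 + m ≤ n) {x y z w : ℕ} {τ : List ℕ}
    (hq : (x, y, z, w) ∈ Sq) (hτ : τ ∈ TL m) (σ : Equiv.Perm (Fin n))
    (h : toL σ = mk m n ((x, y, z, w), τ)) : Shape m n (sv σ) := by
  rw [mem_Sq] at hq
  rw [mem_TL] at hτ
  have hlen : τ.length = m := by simpa using hτ.1.length_eq
  have hlt : ∀ a ∈ τ, a < m := fun a ha => by simpa using hτ.1.mem_iff.1 ha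
  rw [toL_split hn, mk] at h
  simp only [List.cons.injEq] at h
  obtain ⟨h0, h1, h2⟩ := h
  obtain ⟨h3, h4⟩ := List.append_inj h2 (by simp [hlen])
  obtain ⟨h5, h6⟩ := List.append_inj h4 (by simp)
  simp only [List.cons.injEq, and_true] at h6
  have hmid : ∀ i, m + 2 ≤ i → i + 2 < n → sv σ i = i - 2 := by
    intro i hi hi'
    have h7 := congrArg (fun l => l[i - (m + 2)]?) h5
    have h8 : i - (m + 2) < n - 4 - m := by omega
    simp [h8] at h7
    rw [show m + 2 + (i - (m + 2)) = i by omega] at h7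
    omega
  have hlow : ∀ i, 2 ≤ i → i < m + 2 → sv σ i < m := by
    intro i hi hi'
    apply hlt
    rw [← h3]
    apply List.mem_map_of_mem
    rw [List.mem_range'_1]; omega
  refine ⟨?_, ?_, ?_, ?_⟩
  · intro i j hi hij hj
    rcases Nat.lt_or_ge (j + 2) n with hj2 | hj2
    · rw [hmid i hi (by omega), hmid j (by omega) hj2]; omega
    · rcases (show j = n - 2 ∨ j = n - 1 by omega) with rfl | rfl
      · rw [hmid i hi (by omega)]; omega
      · rcases Nat.lt_or_ge (i + 2) n with hi2 | hi2
        · rw [hmid i hi (by omega)]; omega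
        · rw [show i = n - 2 by omega]; omega
  · intro i hi hi'
    have := hlow i hi hi'
    rw [hmid (m + 2) le_rfl (by omega)]; omega
  · rw [hmid (n - 3) (by omega) (by omega)]; omega
  · rw [hmid (n - 3) (by omega) (by omega)]; omega

theorem mk_of_shape {m n : ℕ} (hn : 5 + m ≤ n) (σ : Equiv.Perm (Fin n)) (hav : Avoids132 σ)
    (h : Shape m n (sv σ)) : ∃ q ∈ Sq ×ˢ TL m, mk m n q = toL σ := by
  obtain ⟨hA, hB, hC, hD⟩ := h
  have hp := toL_perm σ
  have hLav := (toL_av σ).2 hav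
  have hsp := toL_split hn σ
  set τ := (List.range' 2 m).map (sv σ) with hτ
  set A := (List.range' (m + 2) (n - 4 - m)).map (sv σ) with hAdef
  have lτ : τ.length = m := by simp [hτ]
  have lA : A.length = n - 4 - m := by simp [hAdef]
  have hv : ∀ i, m + 2 ≤ i → i < n → sv σ (m + 2) ≤ sv σ i := by
    intro i hi hi'
    rcases Nat.lt_or_ge (m + 2) i with h | h
    · exact (hA _ _ le_rfl h hi').le
    · rw [show i = m + 2 by omega]
  have hv' : ∀ i, m + 2 ≤ i → i + 2 < n → sv σ i ≤ sv σ (n - 3) := by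
    intro i hi hi'
    rcases Nat.lt_or_ge i (n - 3) with h | h
    · exact (hA _ _ hi h (by omega)).le
    · rw [show i = n - 3 by omega]
  have mτ : ∀ a ∈ τ, a < sv σ (m + 2) := by
    intro a ha
    simp only [hτ, List.mem_map, List.mem_range'_1] at ha
    obtain ⟨i, hi, rfl⟩ := ha
    exact hB i (by omega) (by omega)
  have mA : ∀ a ∈ A, sv σ (m + 2) ≤ a ∧ a ≤ sv σ (n - 3) := by
    intro a ha
    simp only [hAdef, List.mem_map, List.mem_range'_1] at ha
    obtain ⟨i, hi, rfl⟩ := ha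
    exact ⟨hv i (by omega) (by omega), hv' i (by omega) (by omega)⟩
  have hE : sv σ (n - 3) < sv σ (n - 2) := hA _ _ (by omega) (by omega) (by omega)
  have hF : sv σ (n - 2) < sv σ (n - 1) := hA _ _ (by omega) (by omega) (by omega)
  have hG := hv (n - 3) (by omega) (by omega)
  set F := [sv σ 0, sv σ 1, sv σ (n - 2), sv σ (n - 1)] with hFdef
  have mF : ∀ a ∈ F, sv σ (n - 3) < a := by
    intro a ha
    simp only [hFdef, List.mem_cons, List.not_mem_nil, or_false] at ha
    rcases ha with rfl | rfl | rfl | rfl <;> omega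
  have hperm : (τ ++ (A ++ F)).Perm (List.range' 0 n) := by
    rw [← List.range_eq_range']
    refine List.Perm.trans ?_ hp
    rw [hsp]
    have e1 : (τ ++ (A ++ F)) = (τ ++ A) ++ ([sv σ 0, sv σ 1] ++ [sv σ (n - 2), sv σ (n - 1)]) := by
      simp [hFdef]
    have e2 : sv σ 0 :: sv σ 1 :: (τ ++ (A ++ [sv σ (n - 2), sv σ (n - 1)])) =
        [sv σ 0, sv σ 1] ++ ((τ ++ A) ++ [sv σ (n - 2), sv σ (n - 1)]) := by simp
    rw [e1, e2, ← List.append_assoc, ← List.append_assoc]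
    exact List.Perm.append_right _ List.perm_append_comm
  obtain ⟨pτ, pAF⟩ := split_perm hperm (by
    intro a ha b hb
    have := mτ a ha
    rw [List.mem_append] at hb
    rcases hb with hb | hb
    · have := mA b hb; omega
    · have := mF b hb; omega)
  obtain ⟨pA, pF⟩ := split_perm pAF (by
    intro a ha b hb
    have := mA a ha
    have := mF b hb
    omega)
  rw [lτ, ← List.range_eq_range'] at pτ
  rw [lτ, lA, zero_add] at pA
  rw [lτ, lA, zero_add, show m + (n - 4 - m) = n - 4 by omega] at pF
  have eA : A = List.range' m (n - 4 - m) := by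
    refine pA.eq_of_pairwise' (r := (· ≤ ·)) ?_ (range'_sorted _ _)
    rw [hAdef, List.pairwise_map]
    refine List.Pairwise.imp_of_mem ?_ (List.pairwise_lt_range' (s := m + 2) (n := n - 4 - m))
    intro a b ha hb hab
    rw [List.mem_range'_1] at ha hb
    exact (hA a b ha.1 hab (by omega)).le
  have hFb : ∀ a ∈ F, n - 4 ≤ a ∧ a < n - 4 + 4 := by
    intro a ha
    rw [pF.mem_iff, List.mem_range'_1] at ha
    exact ha
  have b0 := hFb (sv σ 0) (by simp [hFdef])
  have b1 := hFb (sv σ 1) (by simp [hFdef])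
  have b2 := hFb (sv σ (n - 2)) (by simp [hFdef])
  have b3 := hFb (sv σ (n - 1)) (by simp [hFdef])
  have hFnd : F.Nodup := pF.nodup_iff.2 List.nodup_range'
  simp [hFdef] at hFnd
  have av1 : ¬ (sv σ 0 < sv σ (n - 2) ∧ sv σ (n - 2) < sv σ 1) := fun h =>
    av_nat hav (show 0 < 1 by omega) (show 1 < n - 2 by omega) (by omega) h.1 h.2
  have av2 : ¬ (sv σ 0 < sv σ (n - 1) ∧ sv σ (n - 1) < sv σ 1) := fun h =>
    av_nat hav (show 0 < 1 by omega) (show 1 < n - 1 by omega) (by omega) h.1 h.2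
  refine ⟨((sv σ 0 - (n - 4), sv σ 1 - (n - 4), sv σ (n - 2) - (n - 4), sv σ (n - 1) - (n - 4)), τ),
    ?_, ?_⟩
  · rw [Finset.mem_product]
    refine ⟨?_, ?_⟩
    · simp only
      rw [mem_Sq]
      omega
    · simp only
      rw [mem_TL]
      refine ⟨pτ, ?_⟩
      rw [hsp] at hLav
      simp only [LAv, LAv_append τ] at hLav
      exact hLav.2.2.1
  · rw [hsp, eA, mk]
    simp only
    rw [show n - 4 + (sv σ 0 - (n - 4)) = sv σ 0 by omega,
      show n - 4 + (sv σ 1 - (n - 4)) = sv σ 1 by omega,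
      show n - 4 + (sv σ (n - 2) - (n - 4)) = sv σ (n - 2) by omega,
      show n - 4 + (sv σ (n - 1) - (n - 4)) = sv σ (n - 1) by omega]

theorem card_ext {m n : ℕ} (hm : 1 ≤ m) (hn : 5 + m ≤ n) :
    ((Av132 n).filter (fun σ => mmp 2 2 m 0 σ = n - 4 - m)).card = 9 * catalan m := by
  have key : ((Av132 n).filter (fun σ => mmp 2 2 m 0 σ = n - 4 - m)).image toL =
      (Sq ×ˢ TL m).image (mk m n) := by
    ext l
    simp only [Finset.mem_image, Finset.mem_filter, Av132, Finset.mem_univ, true_and]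
    constructor
    · rintro ⟨σ, ⟨h1, h2⟩, rfl⟩
      exact mk_of_shape hn σ h1 (shape_of_mmp hm hn σ h1 h2)
    · rintro ⟨⟨⟨x, y, z, w⟩, τ⟩, hq, rfl⟩
      rw [Finset.mem_product] at hq
      obtain ⟨σ, hσ⟩ := toL_surj _ (mk_perm hn hq.1 hq.2)
      refine ⟨σ, ⟨?_, mmp_of_shape hn σ (shape_of_mk hn hq.1 hq.2 σ hσ)⟩, hσ⟩
      rw [← toL_av, hσ]
      exact mk_av hn hq.1 hq.2
  have h1 := congrArg Finset.card key
  rwa [Finset.card_image_of_injective _ (fun a b h => toL_inj a b h),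
    Finset.card_image_of_injOn (mk_injOn m n), Finset.card_product, card_Sq, card_TL] at h1

theorem coeff_Q (n a b c d r : ℕ) :
    (Q n a b c d).coeff r = (((Av132 n).filter (fun σ => mmp a b c d σ = r)).card : ℤ) := by
  simp only [Q, Polynomial.finsetSum_coeff, Polynomial.coeff_X_pow, Finset.card_filter]
  push_cast
  exact Finset.sum_congr rfl fun σ _ => by simp only [eq_comm]

end MMPaux

/-- for `m ≥ 1` and `n ≥ 5 + m`, the highest power of `x` in
`Q_{n,132}^{(2,2,m,0)}(x)` is `x^{n-4-m}`, with coefficient `9·C_m`. -/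
theorem stmt7 (m n : ℕ) (hm : 1 ≤ m) (hn : 5 + m ≤ n) :
    (Q n 2 2 m 0).coeff (n - 4 - m) = (9 * catalan m : ℤ) ∧
    ∀ r : ℕ, n - 4 - m < r → (Q n 2 2 m 0).coeff r = 0 := by
  refine ⟨?_, fun r hr => ?_⟩
  · rw [MMPaux.coeff_Q, MMPaux.card_ext hm hn]
    push_cast
    rfl
  · rw [MMPaux.coeff_Q, Finset.filter_eq_empty_iff.2]
    · simp
    · intro σ _ h
      have := MMPaux.mmp_le hn σ
      omega
end

section
/- For all k, ℓ, m ≥ 1 and all n ≥ k + m, the polynomials Q_{n,132}^{(0,k,ℓ,m)}(x) satisfy the recurrence Q_{n,132}^{(0,k,ℓ,m)}(x) = Σ_{i=1}^{k-1} C_{i-1} · Q_{n-i,132}^{(0,k-i,ℓ,m)}(x) + Σ_{i=k}^{n-m} Q_{i-1,132}^{(0,k,ℓ,0)}(x) · Q_{n-i,132}^{(0,0,ℓ,m)}(x) + Σ_{i=n-m+1}^{n} Q_{i-1,132}^{(0,k,ℓ,m-(n-i))}(x) · C_{n-i}. -/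
open Finset Polynomial

/-- position of the left block -/
def posL (p q : ℕ) (x : Fin p) : Fin (p + 1 + q) := Fin.castAdd q x.castSucc
/-- position of the maximum -/
def posM (p q : ℕ) : Fin (p + 1 + q) := Fin.castAdd q (Fin.last p)
/-- position of the right block -/
def posR (p q : ℕ) (x : Fin q) : Fin (p + 1 + q) := Fin.natAdd (p + 1) x

@[simp] theorem posL_val (p q : ℕ) (x : Fin p) : (posL p q x : ℕ) = x := rfl
@[simp] theorem posM_val (p q : ℕ) : (posM p q : ℕ) = p := rfl
@[simp] theorem posR_val (p q : ℕ) (x : Fin q) : (posR p q x : ℕ) = p + 1 + x := rfl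

theorem pos_cases {p q : ℕ} (i : Fin (p + 1 + q)) :
    (∃ x, i = posL p q x) ∨ i = posM p q ∨ ∃ x, i = posR p q x := by
  rcases lt_trichotomy (i : ℕ) p with h | h | h
  · exact Or.inl ⟨⟨i, h⟩, Fin.ext rfl⟩
  · exact Or.inr (Or.inl (Fin.ext h))
  · refine Or.inr (Or.inr ⟨⟨i - (p + 1), by omega⟩, Fin.ext ?_⟩)
    simp; omega

theorem card_split (p q : ℕ) (P : Fin (p + 1 + q) → Prop) [DecidablePred P] :
    (univ.filter P).card = (univ.filter (fun x => P (posL p q x))).card +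
      (if P (posM p q) then 1 else 0) + (univ.filter (fun x => P (posR p q x))).card := by
  simp only [Finset.card_filter]
  rw [Fin.sum_univ_add, Fin.sum_univ_castSucc]
  rfl

/-- underlying function of the join -/
def joinFun {p q : ℕ} (α : Equiv.Perm (Fin p)) (β : Equiv.Perm (Fin q)) (i : Fin (p + 1 + q)) :
    Fin (p + 1 + q) :=
  if h : (i : ℕ) < p then ⟨α ⟨i, h⟩ + q, by have := (α ⟨i, h⟩).2; omega⟩
  else if h' : (i : ℕ) = p then ⟨p + q, by omega⟩
  else ⟨β ⟨i - (p + 1), by omega⟩, by have := (β ⟨i - (p + 1), by omega⟩).2; omega⟩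

theorem joinFun_L {p q : ℕ} (α : Equiv.Perm (Fin p)) (β : Equiv.Perm (Fin q)) (x : Fin p) :
    (joinFun α β (posL p q x) : ℕ) = α x + q := by
  simp [joinFun]

theorem joinFun_M {p q : ℕ} (α : Equiv.Perm (Fin p)) (β : Equiv.Perm (Fin q)) :
    (joinFun α β (posM p q) : ℕ) = p + q := by
  simp [joinFun]

theorem joinFun_R {p q : ℕ} (α : Equiv.Perm (Fin p)) (β : Equiv.Perm (Fin q)) (x : Fin q) :
    (joinFun α β (posR p q x) : ℕ) = β x := by
  have h1 : ¬ (p + 1 + (x : ℕ) < p) := by omega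
  have h2 : ¬ (p + 1 + (x : ℕ) = p) := by omega
  simp [joinFun, h1, h2]

theorem joinFun_inj {p q : ℕ} (α : Equiv.Perm (Fin p)) (β : Equiv.Perm (Fin q)) :
    Function.Injective (joinFun α β) := by
  intro i j h
  have h' := congrArg Fin.val h
  rcases pos_cases i with ⟨x, rfl⟩ | rfl | ⟨x, rfl⟩ <;>
  rcases pos_cases j with ⟨y, rfl⟩ | rfl | ⟨y, rfl⟩ <;>
  simp only [joinFun_L, joinFun_M, joinFun_R] at h'
  · have : α x = α y := Fin.ext (by omega)
    rw [α.injective this]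
  · have := (α x).2; omega
  · have := (β y).2; omega
  · have := (α y).2; omega
  · rfl
  · have := (β y).2; omega
  · have := (β x).2; omega
  · have := (β x).2; omega
  · have : β x = β y := Fin.ext (by omega)
    rw [β.injective this]

/-- the permutation `A n B` with all of `A` above all of `B` -/
noncomputable def join {p q : ℕ} (α : Equiv.Perm (Fin p)) (β : Equiv.Perm (Fin q)) :
    Equiv.Perm (Fin (p + 1 + q)) :=
  Equiv.ofBijective (joinFun α β) (Finite.injective_iff_bijective.mp (joinFun_inj α β))

@[simp] theorem join_L {p q : ℕ} (α : Equiv.Perm (Fin p)) (β : Equiv.Perm (Fin q)) (x : Fin p) :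
    (join α β (posL p q x) : ℕ) = α x + q := joinFun_L α β x

@[simp] theorem join_M {p q : ℕ} (α : Equiv.Perm (Fin p)) (β : Equiv.Perm (Fin q)) :
    (join α β (posM p q) : ℕ) = p + q := joinFun_M α β

@[simp] theorem join_R {p q : ℕ} (α : Equiv.Perm (Fin p)) (β : Equiv.Perm (Fin q)) (x : Fin q) :
    (join α β (posR p q x) : ℕ) = β x := joinFun_R α β x

theorem join_avoids {p q : ℕ} (α : Equiv.Perm (Fin p)) (β : Equiv.Perm (Fin q))
    (hα : Avoids132 α) (hβ : Avoids132 β) : Avoids132 (join α β) := by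
  rintro ⟨i, j, k, hij, hjk, h1, h2⟩
  rcases pos_cases i with ⟨x, rfl⟩ | rfl | ⟨x, rfl⟩ <;>
  rcases pos_cases j with ⟨y, rfl⟩ | rfl | ⟨y, rfl⟩ <;>
  rcases pos_cases k with ⟨z, rfl⟩ | rfl | ⟨z, rfl⟩ <;>
  simp only [Fin.lt_def, join_L, join_M, join_R, posL_val, posM_val, posR_val] at hij hjk h1 h2 <;>
  first
  | omega
  | exact hα ⟨x, y, z, by simp only [Fin.lt_def]; omega⟩
  | exact hβ ⟨x, y, z, by simp only [Fin.lt_def]; omega⟩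

theorem join_inj {p q : ℕ} {α α' : Equiv.Perm (Fin p)} {β β' : Equiv.Perm (Fin q)}
    (h : join α β = join α' β') : α = α' ∧ β = β' := by
  constructor
  · ext x
    have := congrArg (fun σ => (σ (posL p q x) : ℕ)) h
    simpa using this
  · ext x
    have := congrArg (fun σ => (σ (posR p q x) : ℕ)) h
    simpa using this

theorem join_surj {p q : ℕ} (σ : Equiv.Perm (Fin (p + 1 + q))) (hσ : Avoids132 σ)
    (hM : (σ (posM p q) : ℕ) = p + q) :
    ∃ α β, Avoids132 α ∧ Avoids132 β ∧ join α β = σ := by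
  have hlt : ∀ i, i ≠ posM p q → (σ i : ℕ) < p + q := by
    intro i hi
    have : σ i ≠ σ (posM p q) := fun h => hi (σ.injective h)
    have h3 : (σ i : ℕ) ≠ p + q := fun h => this (Fin.ext (by omega))
    have := (σ i).2
    omega
  have hLM : ∀ x, posL p q x ≠ posM p q := by
    intro x h; have := congrArg Fin.val h; simp at this; omega
  have hRM : ∀ x, posR p q x ≠ posM p q := by
    intro x h; have := congrArg Fin.val h; simp at this; omega
  have key : ∀ x y, σ (posR p q y) < σ (posL p q x) := by
    intro x y
    by_contra hc
    have hne : σ (posR p q y) ≠ σ (posL p q x) := by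
      intro h
      have := congrArg Fin.val (σ.injective h)
      simp at this; omega
    refine hσ ⟨posL p q x, posM p q, posR p q y, ?_, ?_, ?_, ?_⟩
    · simp [Fin.lt_def]
    · simp [Fin.lt_def]; omega
    · exact lt_of_le_of_ne (not_lt.mp hc) hne.symm
    · have := hlt _ (hRM y); simp only [Fin.lt_def]; omega
  have injR : Function.Injective (posR p q) := by
    intro a b h; have := congrArg Fin.val h; simp at this; exact Fin.ext this
  have injL : Function.Injective (posL p q) := by
    intro a b h; have := congrArg Fin.val h; simp at this; exact Fin.ext this
  have hL : ∀ x, q ≤ (σ (posL p q x) : ℕ) := by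
    intro x
    have h := Finset.card_le_card_of_injOn (s := (univ : Finset (Fin q)))
      (t := Finset.range (σ (posL p q x) : ℕ)) (fun y => (σ (posR p q y) : ℕ))
      (by intro y _; simpa using key x y)
      (by intro a _ b _ h; exact injR (σ.injective (Fin.ext h)))
    simpa using h
  have hR : ∀ y, (σ (posR p q y) : ℕ) < q := by
    intro y
    have h := Finset.card_le_card_of_injOn (s := (univ : Finset (Fin p)))
      (t := Finset.Ioo (σ (posR p q y) : ℕ) (p + q)) (fun x => (σ (posL p q x) : ℕ))
      (by intro x _; simpa using ⟨key x y, hlt _ (hLM x)⟩)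
      (by intro a _ b _ h; exact injL (σ.injective (Fin.ext h)))
    simp only [Finset.card_univ, Fintype.card_fin, Nat.card_Ioo] at h
    have := hlt _ (hRM y)
    omega
  let fα : Fin p → Fin p := fun x => ⟨σ (posL p q x) - q, by
    have := hlt _ (hLM x); have := hL x; omega⟩
  let fβ : Fin q → Fin q := fun y => ⟨σ (posR p q y), hR y⟩
  have iα : Function.Injective fα := by
    intro a b h
    have h' := congrArg Fin.val h
    have h1 := hL a
    have h2 := hL b
    simp only [fα] at h'
    exact injL (σ.injective (Fin.ext (by omega)))
  have iβ : Function.Injective fβ := by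
    intro a b h
    have h' := congrArg Fin.val h
    simp only [fβ] at h'
    exact injR (σ.injective (Fin.ext h'))
  let α : Equiv.Perm (Fin p) := Equiv.ofBijective fα (Finite.injective_iff_bijective.mp iα)
  let β : Equiv.Perm (Fin q) := Equiv.ofBijective fβ (Finite.injective_iff_bijective.mp iβ)
  have eα : ∀ x, (α x : ℕ) = σ (posL p q x) - q := fun x => rfl
  have eβ : ∀ y, (β y : ℕ) = σ (posR p q y) := fun x => rfl
  refine ⟨α, β, ?_, ?_, ?_⟩
  · rintro ⟨i, j, k, hij, hjk, h1, h2⟩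
    have := hL i
    have := hL j
    have := hL k
    simp only [Fin.lt_def, eα] at hij hjk h1 h2
    refine hσ ⟨posL p q i, posL p q j, posL p q k, ?_⟩
    simp only [Fin.lt_def, posL_val]
    omega
  · rintro ⟨i, j, k, hij, hjk, h1, h2⟩
    simp only [Fin.lt_def, eβ] at hij hjk h1 h2
    refine hσ ⟨posR p q i, posR p q j, posR p q k, ?_⟩
    simp only [Fin.lt_def, posR_val]
    omega
  · ext i
    rcases pos_cases i with ⟨x, rfl⟩ | rfl | ⟨x, rfl⟩
    · have := hL x
      rw [join_L, eα]; omega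
    · rw [join_M, hM]
    · rw [join_R, eβ]

theorem sum_join {R : Type*} [AddCommMonoid R] (p q : ℕ) (f : Equiv.Perm (Fin (p + 1 + q)) → R) :
    ∑ σ ∈ (Av132 (p + 1 + q)).filter (fun σ => ∃ h : p < p + 1 + q, (σ ⟨p, h⟩ : ℕ) + 1 = p + 1 + q),
      f σ = ∑ x ∈ Av132 p ×ˢ Av132 q, f (join x.1 x.2) := by
  symm
  refine Finset.sum_bij (fun x _ => join x.1 x.2) ?_ ?_ ?_ ?_
  · rintro ⟨α, β⟩ h
    simp only [Av132, Finset.mem_product, Finset.mem_filter, Finset.mem_univ, true_and] at h ⊢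
    refine ⟨join_avoids _ _ h.1 h.2, by omega, ?_⟩
    have := join_M α β
    change (join α β (posM p q) : ℕ) + 1 = _
    omega
  · rintro ⟨α, β⟩ _ ⟨α', β'⟩ _ h
    obtain ⟨h1, h2⟩ := join_inj h
    simp only at h1 h2
    rw [h1, h2]
  · intro σ h
    simp only [Av132, Finset.mem_filter, Finset.mem_univ, true_and] at h
    obtain ⟨h1, h2, h3⟩ := h
    change (σ (posM p q) : ℕ) + 1 = _ at h3
    obtain ⟨α, β, ha, hb, e⟩ := join_surj σ h1 (by omega)
    exact ⟨(α, β), by simp [Av132, ha, hb], e⟩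
  · intros; rfl

theorem sum_fiber {R : Type*} [AddCommMonoid R] (n : ℕ) (f : Equiv.Perm (Fin (n + 1)) → R) :
    ∑ σ ∈ Av132 (n + 1), f σ = ∑ p ∈ Finset.range (n + 1),
      ∑ σ ∈ (Av132 (n + 1)).filter (fun σ => ∃ h : p < n + 1, (σ ⟨p, h⟩ : ℕ) + 1 = n + 1), f σ := by
  rw [← Finset.sum_fiberwise_of_maps_to (s := Av132 (n + 1)) (t := Finset.range (n + 1))
    (g := fun σ => (σ.symm (Fin.last n) : ℕ)) (f := f)
    (by intro σ _; simp only [Finset.mem_range]; exact (σ.symm (Fin.last n)).2)]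
  refine Finset.sum_congr rfl fun p hp => Finset.sum_congr ?_ fun _ _ => rfl
  ext σ
  simp only [Finset.mem_filter, and_congr_right_iff]
  intro _
  constructor
  · rintro rfl
    exact ⟨(σ.symm (Fin.last n)).2, by simp⟩
  · rintro ⟨h, e⟩
    have : σ ⟨p, h⟩ = Fin.last n := Fin.ext (by simp; omega)
    rw [← this]; simp

theorem card_Av (n : ℕ) : (Av132 n).card = catalan n := by
  induction n using Nat.strong_induction_on with
  | _ n ih =>
    cases n with
    | zero => simp; decide
    | succ n =>
      rw [catalan_succ, Finset.sum_fin_eq_sum_range, Finset.card_eq_sum_ones, sum_fiber]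
      refine Finset.sum_congr rfl fun p hp => ?_
      have hp' : p < n + 1 := Finset.mem_range.mp hp
      rw [dif_pos hp']
      obtain ⟨q, hq⟩ : ∃ q, p + 1 + q = n + 1 := ⟨n - p, by omega⟩
      have hq' : n - p = q := by omega
      simp only [hq']
      rw [← ih p (by omega), ← ih q (by omega), ← Finset.card_product, ← hq, sum_join,
        Finset.card_eq_sum_ones]

theorem matches_L {p q k l m : ℕ} (α : Equiv.Perm (Fin p)) (β : Equiv.Perm (Fin q)) (x : Fin p) :
    MatchesMMP 0 k l m (join α β) (posL p q x) ↔ MatchesMMP 0 k l (m - q) α x := by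
  have a1 : ∀ y : Fin q, ¬ (p + 1 + (y : ℕ) < x) := by intro y; omega
  have a2 : ∀ y : Fin q, (x : ℕ) < p + 1 + y := by intro y; omega
  have a3 : ∀ y : Fin q, (β y : ℕ) < α x + q := by intro y; have := (β y).2; omega
  have a4 : ¬ (p < (x : ℕ)) := by omega
  have a5 : ¬ (p + q < (α x : ℕ) + q) := by omega
  simp only [MatchesMMP, card_split, Fin.lt_def, join_L, join_M, join_R, posL_val, posM_val,
    posR_val, a1, a2, a3, a4, a5]
  simp

theorem not_matches_M {p q k l m : ℕ} (hk : 1 ≤ k) (α : Equiv.Perm (Fin p))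
    (β : Equiv.Perm (Fin q)) : ¬ MatchesMMP 0 k l m (join α β) (posM p q) := by
  rintro ⟨-, h, -⟩
  have a5 : ∀ x, ¬ (p + q < (α x : ℕ) + q) := by intro x; omega
  have a6 : ∀ x : Fin q, ¬ (p + 1 + (x : ℕ) < p) := by intro x; omega
  simp only [card_split, Fin.lt_def, join_L, join_M, join_R, posL_val, posM_val,
    posR_val, a5, a6] at h
  simp at h
  omega

theorem matches_R {p q k l m : ℕ} (α : Equiv.Perm (Fin p)) (β : Equiv.Perm (Fin q)) (y : Fin q) :
    MatchesMMP 0 k l m (join α β) (posR p q y) ↔ MatchesMMP 0 (k - (p + 1)) l m β y := by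
  have a1 : ∀ x : Fin p, ¬ (p + 1 + (y : ℕ) < x) := by intro x; omega
  have a2 : ∀ x : Fin p, (x : ℕ) < p + 1 + y := by intro x; omega
  have a3 : ∀ x : Fin p, (β y : ℕ) < α x + q := by intro x; have := (β y).2; omega
  have a3' : ∀ x : Fin p, ¬ ((α x : ℕ) + q < β y) := by intro x; have := (β y).2; omega
  have a4 : ¬ (p + 1 + (y : ℕ) < p) := by omega
  have a4' : (p < p + 1 + (y : ℕ)) := by omega
  have a5 : (β y : ℕ) < p + q := by omega
  have a5' : ¬ (p + q < (β y : ℕ)) := by omega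
  simp only [MatchesMMP, card_split, Fin.lt_def, join_L, join_M, join_R, posL_val, posM_val,
    posR_val, a1, a2, a3, a3', a4, a4', a5, a5']
  simp
  intros
  omega

theorem mmp_join {p q k l m : ℕ} (hk : 1 ≤ k) (α : Equiv.Perm (Fin p)) (β : Equiv.Perm (Fin q)) :
    mmp 0 k l m (join α β) = mmp 0 k l (m - q) α + mmp 0 (k - (p + 1)) l m β := by
  unfold mmp
  rw [card_split]
  simp only [matches_L, matches_R, not_matches_M hk]
  simp

theorem Q_rec (k l m n : ℕ) (hk : 1 ≤ k) :
    Q (n + 1) 0 k l m = ∑ p ∈ Finset.range (n + 1),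
      Q p 0 k l (m - (n - p)) * Q (n - p) 0 (k - (p + 1)) l m := by
  rw [Q, sum_fiber]
  refine Finset.sum_congr rfl fun p hp => ?_
  have hp' : p < n + 1 := Finset.mem_range.mp hp
  obtain ⟨q, hq⟩ : ∃ q, p + 1 + q = n + 1 := ⟨n - p, by omega⟩
  have hq' : n - p = q := by omega
  rw [hq', ← hq, sum_join, Q, Q, Finset.sum_mul_sum, Finset.sum_product]
  simp only [mmp_join hk, pow_add]

theorem Q_of_le_k (n k l m : ℕ) (h : n ≤ k) (hk : 1 ≤ k) : Q n 0 k l m = (catalan n : ℤ[X]) := by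
  have : ∀ σ : Equiv.Perm (Fin n), mmp 0 k l m σ = 0 := by
    intro σ
    simp only [mmp, Finset.card_eq_zero, Finset.filter_eq_empty_iff]
    rintro i - ⟨-, h2, -⟩
    have : (univ.filter (fun j => j < i ∧ σ i < σ j)).card < n := by
      refine lt_of_lt_of_eq (Finset.card_lt_univ_of_notMem (x := i) (by simp)) (by simp)
    omega
  simp [Q, this, card_Av]

theorem Q_of_le_m (n k l m : ℕ) (h : n ≤ m) (hm : 1 ≤ m) : Q n 0 k l m = (catalan n : ℤ[X]) := by
  have : ∀ σ : Equiv.Perm (Fin n), mmp 0 k l m σ = 0 := by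
    intro σ
    simp only [mmp, Finset.card_eq_zero, Finset.filter_eq_empty_iff]
    rintro i - ⟨-, -, -, h2⟩
    have : (univ.filter (fun j => i < j ∧ σ j < σ i)).card < n := by
      refine lt_of_lt_of_eq (Finset.card_lt_univ_of_notMem (x := i) (by simp)) (by simp)
    omega
  simp [Q, this, card_Av]

/-- the recurrence for `Q_{n,132}^{(0,k,ℓ,m)}(x)` for `k,ℓ,m ≥ 1`, `n ≥ k+m`. -/
theorem stmt8 (k l m n : ℕ) (hk : 1 ≤ k) (hl : 1 ≤ l) (hm : 1 ≤ m) (hn : k + m ≤ n) :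
    Q n 0 k l m =
      (∑ i ∈ Finset.Icc 1 (k - 1),
        (catalan (i - 1) : Polynomial ℤ) * Q (n - i) 0 (k - i) l m) +
      (∑ i ∈ Finset.Icc k (n - m), Q (i - 1) 0 k l 0 * Q (n - i) 0 0 l m) +
      ∑ i ∈ Finset.Icc (n - m + 1) n,
        Q (i - 1) 0 k l (m - (n - i)) * (catalan (n - i) : Polynomial ℤ) := by
  obtain ⟨N, rfl⟩ : ∃ N, n = N + 1 := ⟨n - 1, by omega⟩
  have e : Q (N + 1) 0 k l m = ∑ i ∈ Finset.Icc 1 (N + 1),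
      Q (i - 1) 0 k l (m - (N + 1 - i)) * Q (N + 1 - i) 0 (k - i) l m := by
    have h := Finset.sum_Ico_add' (fun i =>
      Q (i - 1) 0 k l (m - (N + 1 - i)) * Q (N + 1 - i) 0 (k - i) l m) 0 (N + 1) 1
    rw [Q_rec k l m N hk, Finset.range_eq_Ico]
    refine Eq.trans (Finset.sum_congr rfl fun p _ => ?_) (h.trans ?_)
    · simp
    · rfl
  have hs : Finset.Icc 1 (N + 1) = (Finset.Icc 1 (k - 1) ∪ Finset.Icc k (N + 1 - m)) ∪
      Finset.Icc (N + 1 - m + 1) (N + 1) := by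
    ext i; simp only [Finset.mem_union, Finset.mem_Icc]; omega
  rw [e, hs, Finset.sum_union, Finset.sum_union]
  · congr 1
    · congr 1
      · refine Finset.sum_congr rfl fun i hi => ?_
        rw [Finset.mem_Icc] at hi
        rw [Q_of_le_k (i - 1) _ _ _ (by omega) hk]
      · refine Finset.sum_congr rfl fun i hi => ?_
        rw [Finset.mem_Icc] at hi
        rw [show m - (N + 1 - i) = 0 by omega, show k - i = 0 by omega]
    · refine Finset.sum_congr rfl fun i hi => ?_
      rw [Finset.mem_Icc] at hi
      rw [Q_of_le_m (N + 1 - i) _ _ _ (by omega) hm]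
  · rw [Finset.disjoint_left]; intro i; simp only [Finset.mem_Icc]; omega
  · rw [Finset.disjoint_left]; intro i; simp only [Finset.mem_union, Finset.mem_Icc]; omega
end

section
/- For all n ≥ 5, the coefficient of x^{n-4} in the polynomial Q_{n,132}^{(0,1,1,1)}(x) equals 5 + binom(n-2, 2). -/
open Finset Polynomial

namespace M10
open BinaryTree

/-- `y` occurs strictly before `x` in the list. -/
def before : List ℕ → ℕ → ℕ → Prop
  | [], _, _ => False
  | a :: s, y, x => (a = y ∧ x ∈ s) ∨ before s y x

lemma before_append (s t : List ℕ) (y x : ℕ) :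
    before (s ++ t) y x ↔ before s y x ∨ before t y x ∨ (y ∈ s ∧ x ∈ t) := by
  induction s with
  | nil => simp [before]
  | cons a s ih => simp only [List.cons_append, before, ih, List.mem_append, List.mem_cons]; grind

lemma before_mem {l : List ℕ} {y x : ℕ} (h : before l y x) : y ∈ l ∧ x ∈ l := by
  induction l with
  | nil => simp [before] at h
  | cons a s ih => simp only [before] at h; grind

lemma before_split (L R : List ℕ) (m y x : ℕ) :
    before (L ++ m :: R) y x ↔ before L y x ∨ (y = m ∧ x ∈ R) ∨ before R y x ∨
      (y ∈ L ∧ (x = m ∨ x ∈ R)) := by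
  rw [before_append]; simp only [before, List.mem_cons]; grind

def Bf (l : List ℕ) (x : ℕ) : Prop := ∃ y, before l y x ∧ x < y
def Cf (l : List ℕ) (x : ℕ) : Prop := ∃ y, before l y x ∧ y < x
def Df (l : List ℕ) (x : ℕ) : Prop := ∃ y, before l x y ∧ y < x

def Avl (l : List ℕ) : Prop := ∀ a b c, before l a b → before l b c → a < c → c < b → False

structure Good (L R : List ℕ) (m : ℕ) : Prop where
  l : ∀ x ∈ L, x < m
  r : ∀ x ∈ R, x < m
  lr : ∀ x ∈ L, ∀ y ∈ R, y < x

section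
variable {L R : List ℕ} {m : ℕ}

lemma bL (g : Good L R m) {x y} (hx : x ∈ L) : before (L ++ m :: R) y x ↔ before L y x := by
  rw [before_split]
  have := g.l x hx
  have h1 : x ∉ R := fun h => lt_irrefl _ (g.lr x hx x h)
  constructor
  · rintro (h | h | h | h)
    · exact h
    · exact absurd h.2 h1
    · exact absurd (before_mem h).2 h1
    · rcases h.2 with h | h
      · omega
      · exact absurd h h1
  · exact Or.inl

lemma bL2 (g : Good L R m) {x y} (hx : x ∈ L) :
    before (L ++ m :: R) x y ↔ before L x y ∨ y = m ∨ y ∈ R := by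
  rw [before_split]
  have := g.l x hx
  have h1 : x ∉ R := fun h => lt_irrefl _ (g.lr x hx x h)
  constructor
  · rintro (h | h | h | h)
    · exact Or.inl h
    · omega
    · exact absurd (before_mem h).1 h1
    · exact Or.inr h.2
  · rintro (h | h)
    · exact Or.inl h
    · exact Or.inr (Or.inr (Or.inr ⟨hx, h⟩))

lemma bR (g : Good L R m) {x y} (hx : x ∈ R) :
    before (L ++ m :: R) y x ↔ before R y x ∨ y = m ∨ y ∈ L := by
  rw [before_split]
  have h1 : x ∉ L := fun h => lt_irrefl _ (g.lr x h x hx)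
  constructor
  · rintro (h | h | h | h)
    · exact absurd (before_mem h).2 h1
    · exact Or.inr (Or.inl h.1)
    · exact Or.inl h
    · exact Or.inr (Or.inr h.1)
  · rintro (h | h | h)
    · exact Or.inr (Or.inr (Or.inl h))
    · exact Or.inr (Or.inl ⟨h, hx⟩)
    · exact Or.inr (Or.inr (Or.inr ⟨h, Or.inr hx⟩))

lemma bR2 (g : Good L R m) {x y} (hx : x ∈ R) : before (L ++ m :: R) x y ↔ before R x y := by
  rw [before_split]
  have := g.r x hx
  have h1 : x ∉ L := fun h => lt_irrefl _ (g.lr x h x hx)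
  constructor
  · rintro (h | h | h | h)
    · exact absurd (before_mem h).1 h1
    · omega
    · exact h
    · exact absurd h.1 h1
  · exact fun h => Or.inr (Or.inr (Or.inl h))

lemma bM (g : Good L R m) {y} : before (L ++ m :: R) y m ↔ y ∈ L := by
  rw [before_split]
  have h1 : m ∉ L := fun h => lt_irrefl _ (g.l m h)
  have h2 : m ∉ R := fun h => lt_irrefl _ (g.r m h)
  have h3 : ¬ before L y m := fun h => h1 (before_mem h).2
  have h4 : ¬ before R y m := fun h => h2 (before_mem h).2
  simp [h2, h3, h4]

lemma bM2 (g : Good L R m) {y} : before (L ++ m :: R) m y ↔ y ∈ R := by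
  rw [before_split]
  have h1 : m ∉ L := fun h => lt_irrefl _ (g.l m h)
  have h2 : m ∉ R := fun h => lt_irrefl _ (g.r m h)
  have h3 : ¬ before L m y := fun h => h1 (before_mem h).1
  have h4 : ¬ before R m y := fun h => h2 (before_mem h).1
  simp [h1, h3, h4]

lemma BL (g : Good L R m) {x} (hx : x ∈ L) : Bf (L ++ m :: R) x ↔ Bf L x := by
  simp only [Bf, bL g hx]
lemma CL (g : Good L R m) {x} (hx : x ∈ L) : Cf (L ++ m :: R) x ↔ Cf L x := by
  simp only [Cf, bL g hx]
lemma DL (g : Good L R m) {x} (hx : x ∈ L) : Df (L ++ m :: R) x ↔ Df L x ∨ R ≠ [] := by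
  simp only [Df, bL2 g hx]
  constructor
  · rintro ⟨y, h | h | h, hy⟩
    · exact Or.inl ⟨y, h, hy⟩
    · have := g.l x hx; omega
    · exact Or.inr (List.ne_nil_of_mem h)
  · rintro (⟨y, h, hy⟩ | h)
    · exact ⟨y, Or.inl h, hy⟩
    · obtain ⟨y, hy⟩ := List.exists_mem_of_ne_nil _ h
      exact ⟨y, Or.inr (Or.inr hy), g.lr x hx y hy⟩
lemma BM (g : Good L R m) : ¬ Bf (L ++ m :: R) m := by
  rintro ⟨y, h, hy⟩
  rw [bM g] at h
  have := g.l y h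
  omega
lemma CM (g : Good L R m) : Cf (L ++ m :: R) m ↔ L ≠ [] := by
  simp only [Cf, bM g]
  constructor
  · rintro ⟨y, h, _⟩; exact List.ne_nil_of_mem h
  · intro h
    obtain ⟨y, hy⟩ := List.exists_mem_of_ne_nil _ h
    exact ⟨y, hy, g.l y hy⟩
lemma DM (g : Good L R m) : Df (L ++ m :: R) m ↔ R ≠ [] := by
  simp only [Df, bM2 g]
  constructor
  · rintro ⟨y, h, _⟩; exact List.ne_nil_of_mem h
  · intro h
    obtain ⟨y, hy⟩ := List.exists_mem_of_ne_nil _ h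
    exact ⟨y, hy, g.r y hy⟩
lemma BR (g : Good L R m) {x} (hx : x ∈ R) : Bf (L ++ m :: R) x :=
  ⟨m, (bR g hx).2 (Or.inr (Or.inl rfl)), g.r x hx⟩
lemma CR (g : Good L R m) {x} (hx : x ∈ R) : Cf (L ++ m :: R) x ↔ Cf R x := by
  simp only [Cf, bR g hx]
  constructor
  · rintro ⟨y, h | h | h, hy⟩
    · exact ⟨y, h, hy⟩
    · have := g.r x hx; omega
    · have := g.lr y h x hx; omega
  · rintro ⟨y, h, hy⟩; exact ⟨y, Or.inl h, hy⟩
lemma DR (g : Good L R m) {x} (hx : x ∈ R) : Df (L ++ m :: R) x ↔ Df R x := by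
  simp only [Df, bR2 g hx]

lemma Avl_split (g : Good L R m) : Avl (L ++ m :: R) ↔ Avl L ∧ Avl R := by
  constructor
  · intro h
    refine ⟨fun a b c h1 h2 => h a b c ?_ ?_, fun a b c h1 h2 => h a b c ?_ ?_⟩
    · exact (bL g (before_mem h1).2).2 h1
    · exact (bL g (before_mem h2).2).2 h2
    · exact (bR2 g (before_mem h1).1).2 h1
    · exact (bR2 g (before_mem h2).1).2 h2
  · rintro ⟨hL, hR⟩ a b c h1 h2 hac hcb
    have hb := (before_mem h1).2
    have ha := (before_mem h1).1
    have hc := (before_mem h2).2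
    simp only [List.mem_append, List.mem_cons] at hb ha hc
    rcases hc with hc | rfl | hc
    · rw [bL g hc] at h2
      rw [bL g (before_mem h2).1] at h1
      exact hL a b c h1 h2 hac hcb
    · rcases hb with hb | rfl | hb
      · have := g.l b hb; omega
      · omega
      · have := g.r b hb; omega
    · rcases ha with ha | rfl | ha
      · have := g.lr a ha c hc; omega
      · have := g.r c hc; omega
      · rw [bR2 g ha] at h1
        rw [bR2 g (before_mem h1).2] at h2
        exact hR a b c h1 h2 hac hcb

open Classical in
noncomputable def dA (l : List ℕ) : ℕ := l.countP (fun x => ¬ (Bf l x ∧ Cf l x ∧ Df l x))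
open Classical in
noncomputable def dB (l : List ℕ) : ℕ := l.countP (fun x => ¬ (Bf l x ∧ Cf l x))
open Classical in
noncomputable def dC (l : List ℕ) : ℕ := l.countP (fun x => ¬ (Cf l x))
open Classical in
noncomputable def dD (l : List ℕ) : ℕ := l.countP (fun x => ¬ (Cf l x ∧ Df l x))

lemma countP_split (p q r : ℕ → Bool) (hL : ∀ x ∈ L, p x = q x) (hR : ∀ x ∈ R, p x = r x) :
    (L ++ m :: R).countP p = L.countP q + (if p m then 1 else 0) + R.countP r := by
  rw [List.countP_append, List.countP_cons, List.countP_congr (l := L) (q := q),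
    List.countP_congr (l := R) (q := r)]
  · omega
  · intro x hx; rw [hR x hx]
  · intro x hx; rw [hL x hx]

lemma dC_split (g : Good L R m) :
    dC (L ++ m :: R) = dC L + (if L = [] then 1 else 0) + dC R := by
  classical
  unfold dC
  rw [countP_split _ (fun x => ¬ Cf L x) (fun x => ¬ Cf R x)]
  · simp [CM g]
  · intro x hx; simp [CL g hx]
  · intro x hx; simp [CR g hx]

lemma dB_split (g : Good L R m) :
    dB (L ++ m :: R) = dB L + 1 + dC R := by
  classical
  unfold dB dC
  rw [countP_split _ (fun x => ¬ (Bf L x ∧ Cf L x)) (fun x => ¬ Cf R x)]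
  · simp [BM g]
  · intro x hx; simp [BL g hx, CL g hx]
  · intro x hx; simp [BR g hx, CR g hx]

lemma dD_split (g : Good L R m) :
    dD (L ++ m :: R) = if R = [] then dD L + 1 else
      dC L + (if L = [] then 1 else 0) + dD R := by
  classical
  split_ifs with h h2
  · unfold dD
    rw [countP_split _ (fun x => ¬ (Cf L x ∧ Df L x)) (fun x => ¬ (Cf R x ∧ Df R x))]
    · simp only [DM g]; simp [h]
    · intro x hx; simp only [CL g hx, DL g hx]; simp [h]
    · intro x hx; simp [CR g hx, DR g hx]
  all_goals
    unfold dD dC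
    rw [countP_split _ (fun x => ¬ (Cf L x)) (fun x => ¬ (Cf R x ∧ Df R x))]
    · simp only [DM g, CM g]; simp [h, h2]
    · intro x hx; simp [CL g hx, DL g hx, h]
    · intro x hx; simp [CR g hx, DR g hx]

lemma dA_split (g : Good L R m) :
    dA (L ++ m :: R) = if R = [] then dA L + 1 else dB L + 1 + dD R := by
  classical
  split_ifs with h
  · unfold dA
    rw [countP_split _ (fun x => ¬ (Bf L x ∧ Cf L x ∧ Df L x)) (fun x => ¬ (Cf R x ∧ Df R x))]
    · subst h; simp [BM g]
    · intro x hx; simp only [BL g hx, CL g hx, DL g hx]; simp [h]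
    · intro x hx; simp [BR g hx, CR g hx, DR g hx]
  · unfold dA dB dD
    rw [countP_split _ (fun x => ¬ (Bf L x ∧ Cf L x)) (fun x => ¬ (Cf R x ∧ Df R x))]
    · simp [BM g]
    · intro x hx; simp [BL g hx, CL g hx, DL g hx, h]
    · intro x hx; simp [BR g hx, CR g hx, DR g hx]
end

/-- The 132-avoiding word on `off, …, off + numNodes - 1` encoded by a tree. -/
def enc : ℕ → BinaryTree Unit → List ℕ
  | _, .nil => []
  | off, .node _ l r =>
    enc (off + r.numNodes) l ++ (off + l.numNodes + r.numNodes) :: enc off r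

lemma enc_length (off : ℕ) (t : BinaryTree Unit) : (enc off t).length = t.numNodes := by
  induction t generalizing off with
  | nil => rfl
  | node v l r hl hr => simp [enc, hl, hr]; omega

lemma enc_mem (off : ℕ) (t : BinaryTree Unit) (x : ℕ) :
    x ∈ enc off t ↔ off ≤ x ∧ x < off + t.numNodes := by
  induction t generalizing off with
  | nil => simp [enc]
  | node v l r hl hr => simp [enc, hl, hr]; omega

lemma enc_good (off : ℕ) (l r : BinaryTree Unit) :
    Good (enc (off + r.numNodes) l) (enc off r) (off + l.numNodes + r.numNodes) := by
  constructor <;> intro x hx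
  · rw [enc_mem] at hx; omega
  · rw [enc_mem] at hx; omega
  · intro y hy; rw [enc_mem] at hx hy; omega

lemma enc_nodup (off : ℕ) (t : BinaryTree Unit) : (enc off t).Nodup := by
  induction t generalizing off with
  | nil => simp [enc]
  | node v l r hl hr =>
    simp only [enc]
    rw [List.nodup_append, List.nodup_cons]
    refine ⟨hl _, ⟨?_, hr _⟩, ?_⟩
    · rw [enc_mem]; omega
    · intro a ha b hb
      rw [List.mem_cons] at hb
      rw [enc_mem] at ha hb; omega

lemma enc_avl (off : ℕ) (t : BinaryTree Unit) : Avl (enc off t) := by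
  induction t generalizing off with
  | nil => intro a b c h; simp [enc, before] at h
  | node v l r hl hr => exact (Avl_split (enc_good off l r)).2 ⟨hl _, hr _⟩

lemma enc_eq_nil {off : ℕ} {t : BinaryTree Unit} : enc off t = [] ↔ t = .nil := by
  cases t <;> simp [enc]

lemma split_unique {m : ℕ} {l1 l2 r1 r2 : List ℕ} (h1 : m ∉ l1) (h2 : m ∉ l2)
    (h : l1 ++ m :: r1 = l2 ++ m :: r2) : l1 = l2 ∧ r1 = r2 := by
  induction l1 generalizing l2 with
  | nil => cases l2 <;> simp_all
  | cons a l1 ih => cases l2 <;> grind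

lemma enc_inj (off : ℕ) (t t' : BinaryTree Unit) (h : enc off t = enc off t') : t = t' := by
  induction t generalizing off t' with
  | nil => exact (enc_eq_nil.1 h.symm).symm
  | node v l r hl hr =>
    cases t' with
    | nil => simp [enc] at h
    | node v' l' r' =>
      have hn := congrArg List.length h
      rw [enc_length, enc_length] at hn
      simp only [numNodes] at hn
      simp only [enc] at h
      have e : off + l.numNodes + r.numNodes = off + l'.numNodes + r'.numNodes := by omega
      rw [e] at h
      have := split_unique (by rw [enc_mem]; omega) (by rw [enc_mem]; omega) h
      have hr' := hr _ _ this.2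
      subst hr'
      have hl' := hl _ _ this.1
      subst hl'
      rfl

lemma enc_surj (n : ℕ) : ∀ (off : ℕ) (w : List ℕ), w.Nodup →
    (∀ x, x ∈ w ↔ off ≤ x ∧ x < off + n) → Avl w → ∃ t : BinaryTree Unit,
      t.numNodes = n ∧ enc off t = w := by
  induction n using Nat.strong_induction_on with
  | _ n ih =>
  intro off w hnd hmem hav
  rcases Nat.eq_zero_or_pos n with rfl | hn
  · refine ⟨.nil, rfl, ?_⟩
    rw [eq_comm, enc, List.eq_nil_iff_forall_not_mem]
    intro x hx
    have := (hmem x).1 hx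
    omega
  · have hm : off + n - 1 ∈ w := (hmem _).2 (by omega)
    obtain ⟨L, R, rfl⟩ := List.append_of_mem hm
    rw [List.nodup_append, List.nodup_cons] at hnd
    obtain ⟨hL, ⟨hmR, hR⟩, hd⟩ := hnd
    simp only [List.mem_append, List.mem_cons] at hmem
    have g : Good L R (off + n - 1) := by
      constructor
      · intro x hx
        have := (hmem x).1 (Or.inl hx)
        have := hd x hx (off + n - 1) (by simp)
        omega
      · intro x hx
        have := (hmem x).1 (Or.inr (Or.inr hx))
        have : x ≠ off + n - 1 := by rintro rfl; exact hmR hx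
        omega
      · intro x hx y hy
        by_contra hlt
        have h1 := (hmem y).1 (Or.inr (Or.inr hy))
        have h2 : y ≠ off + n - 1 := by rintro rfl; exact hmR hy
        have h3 := hd x hx y (by simp [hy])
        refine hav x (off + n - 1) y ?_ ?_ (by omega) (by omega)
        · rw [before_split]; simp [hx]
        · rw [before_split]; simp [hy]
    obtain ⟨aL, aR⟩ := (Avl_split g).1 hav
    -- the threshold
    have key : ∀ k, k ≤ n - 1 → (∀ x ∈ R, x < off + k) → (∀ x ∈ L, off + k ≤ x) →
        ∃ t : BinaryTree Unit, t.numNodes = n ∧ enc off t = L ++ (off + n - 1) :: R := by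
      intro k hk h1 h2
      obtain ⟨r, hr, er⟩ := ih k (by omega) off R hR (by
        intro x
        constructor
        · intro hx; exact ⟨((hmem x).1 (Or.inr (Or.inr hx))).1, h1 x hx⟩
        · rintro ⟨ha, hb⟩
          rcases (hmem x).2 (by omega) with h | h | h
          · have := h2 x h; omega
          · omega
          · exact h) aR
      obtain ⟨l, hl, el⟩ := ih (n - 1 - k) (by omega) (off + k) L hL (by
        intro x
        constructor
        · intro hx
          have := g.l x hx
          have := h2 x hx
          omega
        · rintro ⟨ha, hb⟩
          rcases (hmem x).2 (by omega) with h | h | h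
          · exact h
          · omega
          · have := h1 x h; omega) aL
      refine ⟨.node () l r, by simp [hr, hl]; omega, ?_⟩
      simp only [enc, hr, hl, el, er]
      congr 2
      omega
    -- k = number of elements below all of L
    by_cases hLe : ∃ k, off + k ∈ L
    · classical
      have hf := Nat.find_spec hLe
      have hmin : ∀ j, j < Nat.find hLe → off + j ∉ L := fun j hj => Nat.find_min hLe hj
      have := g.l _ hf
      refine key (Nat.find hLe) (by omega) ?_ ?_
      · intro x hx; exact g.lr _ hf x hx
      · intro x hx
        by_contra hlt
        have := (hmem x).1 (Or.inl hx)
        apply hmin (x - off) (by omega)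
        rwa [show off + (x - off) = x by omega]
    · refine key (n - 1) le_rfl ?_ ?_
      · intro x hx; have := g.r x hx; omega
      · intro x hx
        exfalso
        have := (hmem x).1 (Or.inl hx)
        exact hLe ⟨x - off, by rwa [show off + (x - off) = x by omega]⟩

/-- Tree statistics. -/
def tC : BinaryTree Unit → ℕ
  | .nil => 0
  | .node _ l r => tC l + (if l = .nil then 1 else 0) + tC r
def tB : BinaryTree Unit → ℕ
  | .nil => 0
  | .node _ l r => tB l + 1 + tC r
def tD : BinaryTree Unit → ℕ
  | .nil => 0
  | .node _ l r => if r = .nil then tD l + 1 else tC l + (if l = .nil then 1 else 0) + tD r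
def tA : BinaryTree Unit → ℕ
  | .nil => 0
  | .node _ l r => if r = .nil then tA l + 1 else tB l + 1 + tD r

lemma dC_enc (off : ℕ) (t : BinaryTree Unit) : dC (enc off t) = tC t := by
  induction t generalizing off with
  | nil => simp [enc, dC, tC]
  | node v l r hl hr => simp only [enc, dC_split (enc_good off l r), tC, hl, hr, enc_eq_nil]
lemma dB_enc (off : ℕ) (t : BinaryTree Unit) : dB (enc off t) = tB t := by
  induction t generalizing off with
  | nil => simp [enc, dB, tB]
  | node v l r hl hr => simp only [enc, dB_split (enc_good off l r), tB, hl, dC_enc]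
lemma dD_enc (off : ℕ) (t : BinaryTree Unit) : dD (enc off t) = tD t := by
  induction t generalizing off with
  | nil => simp [enc, dD, tD]
  | node v l r hl hr =>
    simp only [enc, dD_split (enc_good off l r), tD, hl, hr, dC_enc, enc_eq_nil]
lemma dA_enc (off : ℕ) (t : BinaryTree Unit) : dA (enc off t) = tA t := by
  induction t generalizing off with
  | nil => simp [enc, dA, tA]
  | node v l r hl hr =>
    simp only [enc, dA_split (enc_good off l r), tA, hl, dB_enc, dD_enc, enc_eq_nil]

noncomputable def P (f : BinaryTree Unit → ℕ) (n : ℕ) : ℕ[X] :=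
  ∑ t ∈ treesOfNumNodesEq n, X ^ f t

lemma sum_trees (F : BinaryTree Unit → ℕ[X]) (n : ℕ) :
    ∑ t ∈ treesOfNumNodesEq (n + 1), F t = ∑ ij ∈ antidiagonal n,
      ∑ l ∈ treesOfNumNodesEq ij.1, ∑ r ∈ treesOfNumNodesEq ij.2, F (.node () l r) := by
  rw [treesOfNumNodesEq_succ, sum_biUnion]
  · refine sum_congr rfl fun ij _ => ?_
    rw [sum_map, sum_product]
    rfl
  · simp_rw [Set.PairwiseDisjoint, Set.Pairwise, disjoint_left]
    aesop

lemma nil_iff {t : BinaryTree Unit} {n : ℕ} (h : t ∈ treesOfNumNodesEq n) :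
    t = .nil ↔ n = 0 := by
  rw [mem_treesOfNumNodesEq] at h
  subst h
  cases t <;> simp

lemma P_zero (f : BinaryTree Unit → ℕ) (h : f .nil = 0) : P f 0 = 1 := by
  simp [P, h]

lemma PC_succ (n : ℕ) : P tC (n + 1) = ∑ ij ∈ antidiagonal n,
    P tC ij.1 * (if ij.1 = 0 then X else 1) * P tC ij.2 := by
  rw [P, sum_trees]
  refine sum_congr rfl fun ij _ => ?_
  rw [P, P, sum_mul, sum_mul_sum]
  refine sum_congr rfl fun l hl => sum_congr rfl fun r hr => ?_
  simp only [tC, nil_iff hl]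
  split_ifs <;> ring

lemma PB_succ (n : ℕ) : P tB (n + 1) = ∑ ij ∈ antidiagonal n,
    P tB ij.1 * X * P tC ij.2 := by
  rw [P, sum_trees]
  refine sum_congr rfl fun ij _ => ?_
  rw [P, P, sum_mul, sum_mul_sum]
  refine sum_congr rfl fun l hl => sum_congr rfl fun r hr => ?_
  simp only [tB]
  ring

lemma PD_succ (n : ℕ) : P tD (n + 1) = ∑ ij ∈ antidiagonal n,
    if ij.2 = 0 then X * P tD n else
      P tC ij.1 * (if ij.1 = 0 then X else 1) * P tD ij.2 := by
  rw [P, sum_trees]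
  refine sum_congr rfl fun ij hij => ?_
  split_ifs with h h1
  · have : ij.1 = n := by have := mem_antidiagonal.1 hij; omega
    rw [h, this, P, mul_sum]
    refine sum_congr rfl fun l hl => ?_
    simp [tD, pow_succ']
  all_goals
    rw [P, P, sum_mul, sum_mul_sum]
    refine sum_congr rfl fun l hl => sum_congr rfl fun r hr => ?_
    simp only [tD, nil_iff hl, nil_iff hr, h, h1, if_true, if_false]
    ring

lemma PA_succ (n : ℕ) : P tA (n + 1) = ∑ ij ∈ antidiagonal n,
    if ij.2 = 0 then X * P tA n else
      P tB ij.1 * X * P tD ij.2 := by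
  rw [P, sum_trees]
  refine sum_congr rfl fun ij hij => ?_
  split_ifs with h
  · have : ij.1 = n := by have := mem_antidiagonal.1 hij; omega
    rw [h, this, P, mul_sum]
    refine sum_congr rfl fun l hl => ?_
    simp [tA, pow_succ']
  · rw [P, P, sum_mul, sum_mul_sum]
    refine sum_congr rfl fun l hl => sum_congr rfl fun r hr => ?_
    simp only [tA, nil_iff hr, h, if_false]
    ring

lemma sing1 (n k : ℕ) (g : ℕ → ℕ) :
    ∑ p ∈ antidiagonal n, (if p.1 = k then 1 else 0) * g p.2 = if k ≤ n then g (n - k) else 0 := by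
  rw [Finset.Nat.sum_antidiagonal_eq_sum_range_succ (fun i j => (if i = k then 1 else 0) * g j)]
  simp [Finset.sum_ite_eq', Nat.lt_succ_iff]

lemma sing2 (n k : ℕ) (g : ℕ → ℕ) :
    ∑ p ∈ antidiagonal n, g p.1 * (if p.2 = k then 1 else 0) = if k ≤ n then g (n - k) else 0 := by
  rw [← sing1, ← Finset.Nat.sum_antidiagonal_swap]
  simp [mul_comm]

lemma co1 (p q : ℕ[X]) : (p * q).coeff 1 = p.coeff 0 * q.coeff 1 + p.coeff 1 * q.coeff 0 := by
  simp [coeff_mul, Finset.Nat.antidiagonal_succ]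
lemma co2 (p q : ℕ[X]) : (p * q).coeff 2 = p.coeff 0 * q.coeff 2 + p.coeff 1 * q.coeff 1
    + p.coeff 2 * q.coeff 0 := by
  simp [coeff_mul, Finset.Nat.antidiagonal_succ]; ring
lemma co3 (p q : ℕ[X]) : (p * q).coeff 3 = p.coeff 0 * q.coeff 3 + p.coeff 1 * q.coeff 2
    + p.coeff 2 * q.coeff 1 + p.coeff 3 * q.coeff 0 := by
  simp [coeff_mul, Finset.Nat.antidiagonal_succ]; ring

lemma PC_one : P tC 1 = X := by simp [PC_succ, P_zero tC rfl]
lemma PB_one : P tB 1 = X := by simp [PB_succ, P_zero tB rfl, P_zero tC rfl]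
lemma PD_one : P tD 1 = X := by simp [PD_succ, P_zero tD rfl]
lemma PA_one : P tA 1 = X := by simp [PA_succ, P_zero tA rfl]

lemma PC_two (n : ℕ) : P tC (n + 2) = X * P tC (n + 1) +
    ∑ p ∈ antidiagonal n, P tC (p.1 + 1) * P tC p.2 := by
  rw [PC_succ, Finset.Nat.sum_antidiagonal_succ]
  simp [P_zero tC rfl]

lemma PB_two (n : ℕ) : P tB (n + 1) = X * ∑ p ∈ antidiagonal n, P tB p.1 * P tC p.2 := by
  rw [PB_succ, mul_sum]
  refine sum_congr rfl fun p _ => by ring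

lemma PD_two : P tD 2 = 2 * X ^ 2 := by
  rw [PD_succ]
  simp [Finset.Nat.antidiagonal_succ, P_zero tC rfl, PD_one]
  ring

lemma PD_three (n : ℕ) : P tD (n + 3) = X * (2 * P tD (n + 2)) +
    ∑ p ∈ antidiagonal n, P tC (p.1 + 1) * P tD (p.2 + 1) := by
  rw [PD_succ, Finset.Nat.sum_antidiagonal_succ', Finset.Nat.sum_antidiagonal_succ]
  simp [P_zero tC rfl]
  ring

lemma PA_two (n : ℕ) : P tA (n + 2) = X * (P tA (n + 1) +
    ∑ p ∈ antidiagonal n, P tB p.1 * P tD (p.2 + 1)) := by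
  rw [PA_succ, Finset.Nat.sum_antidiagonal_succ', mul_add, mul_sum]
  simp
  congr 1
  refine sum_congr rfl fun p _ => by ring

lemma c0 (n : ℕ) : (P tC n).coeff 0 = if n = 0 then 1 else 0 := by
  induction n using Nat.strong_induction_on with
  | _ n ih =>
  rcases n with _ | _ | n
  · simp [P_zero tC rfl]
  · simp [PC_one]
  · rw [PC_two]
    simp only [coeff_add, finsetSum_coeff, mul_coeff_zero, coeff_X_zero, zero_mul, zero_add]
    rw [sum_eq_zero]
    · simp
    · intro p hp
      have := mem_antidiagonal.1 hp
      rw [ih (p.1 + 1) (by omega)]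
      simp

lemma c1 (n : ℕ) : (P tC n).coeff 1 = if n = 0 then 0 else 1 := by
  induction n using Nat.strong_induction_on with
  | _ n ih =>
  rcases n with _ | _ | n
  · simp [P_zero tC rfl, coeff_one]
  · simp [PC_one]
  · rw [PC_two]
    simp only [coeff_add, finsetSum_coeff, co1, coeff_X_zero, coeff_X_one, c0]
    simp only [sum_add_distrib, sing2 n 0 (fun i => (P tC (i + 1)).coeff 1)]
    simp [ih (n + 1) (by omega)]

lemma c2 (n : ℕ) : (P tC n).coeff 2 = n.choose 2 := by
  induction n using Nat.strong_induction_on with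
  | _ n ih =>
  rcases n with _ | _ | n
  · simp [P_zero tC rfl, coeff_one]
  · simp [PC_one, coeff_X]
  · rw [PC_two]
    simp only [coeff_add, finsetSum_coeff, co2, coeff_X_zero, coeff_X_one, c0, c1]
    simp only [sum_add_distrib, sing2 n 0 (fun i => (P tC (i + 1)).coeff 2)]
    have : ∑ p ∈ antidiagonal n, (if p.2 = 0 then 0 else 1) = n := by
      cases n with
      | zero => simp
      | succ n => simp [Finset.Nat.sum_antidiagonal_succ']
    simp [ih (n + 1) (by omega), this, Nat.choose_succ_succ]
    omega

lemma b0 (n : ℕ) : (P tB n).coeff 0 = if n = 0 then 1 else 0 := by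
  cases n with
  | zero => simp [P_zero tB rfl]
  | succ n => simp [PB_two]

lemma b1 (n : ℕ) : (P tB n).coeff 1 = if n = 1 then 1 else 0 := by
  cases n with
  | zero => simp [P_zero tB rfl, coeff_one]
  | succ n =>
    rw [PB_two, coeff_X_mul (n := 0), finsetSum_coeff]
    simp only [mul_coeff_zero, b0, c0, sing1 n 0 (fun j => if j = 0 then 1 else 0)]
    simp

lemma b2 (n : ℕ) : (P tB (n + 3)).coeff 2 = 1 := by
  rw [PB_two, coeff_X_mul (n := 1), finsetSum_coeff]
  simp only [co1, b0, c0, b1, c1, sum_add_distrib, sing1 _ 0 (fun j => if j = 0 then 0 else 1),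
    sing1 _ 1 (fun j => if j = 0 then 1 else 0)]
  simp

lemma d0 (n : ℕ) : (P tD (n + 1)).coeff 0 = 0 := by
  rcases n with _ | _ | n
  · simp [PD_one]
  · simp [PD_two]
  · simp [PD_three, finsetSum_coeff, c0]

lemma d1 (n : ℕ) : (P tD (n + 1)).coeff 1 = if n = 0 then 1 else 0 := by
  rcases n with _ | _ | n
  · simp [PD_one]
  · simp [PD_two, coeff_X_pow]
  · simp [PD_three, finsetSum_coeff, co1, c0, d0]

lemma cm2 (p : ℕ[X]) (k : ℕ) : (2 * p).coeff k = 2 * p.coeff k := by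
  rw [two_mul, coeff_add, two_mul]

lemma d2 (n : ℕ) : (P tD (n + 1)).coeff 2 = if n = 0 then 0 else if n = 1 then 2 else 1 := by
  rcases n with _ | _ | n
  · simp [PD_one, coeff_X]
  · simp [PD_two, cm2]
  · rw [PD_three, coeff_add, coeff_X_mul (n := 1), finsetSum_coeff, cm2, d1]
    simp only [co2, d0, c0, d1, sum_add_distrib, sing2 n 0 (fun i => (P tC (i + 1)).coeff 1)]
    simp [c1]

lemma d3 (n : ℕ) : (P tD (n + 4)).coeff 3 = 2 + (n + 2) + (n + 2).choose 2 := by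
  rw [PD_three, coeff_add, coeff_X_mul (n := 2), finsetSum_coeff, cm2, d2]
  simp only [co3, d0, c0, d1, sum_add_distrib, c1,
    sing2 (n + 1) 0 (fun i => (P tC (i + 1)).coeff 2)]
  have : ∑ p ∈ antidiagonal (n + 1), (P tD (p.2 + 1)).coeff 2 = n + 2 := by
    simp only [d2]
    rw [Finset.Nat.sum_antidiagonal_succ']
    induction n with
    | zero => simp
    | succ n ih =>
      rw [Finset.Nat.sum_antidiagonal_succ]
      simp at ih ⊢
      omega
  simp [this, c2, add_assoc]

lemma a0 (n : ℕ) : (P tA (n + 1)).coeff 0 = 0 := by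
  rcases n with _ | n
  · simp [PA_one]
  · simp [PA_two]

lemma a1 (n : ℕ) : (P tA (n + 2)).coeff 1 = 0 := by
  rw [PA_two, coeff_X_mul (n := 0), coeff_add, finsetSum_coeff]
  simp [a0, d0]

lemma a2 (n : ℕ) : (P tA (n + 3)).coeff 2 = 0 := by
  rw [PA_two, coeff_X_mul (n := 1), coeff_add, finsetSum_coeff]
  simp only [a1, co1, d0, b0, sum_add_distrib, sing1 _ 0 (fun j => (P tD (j + 1)).coeff 1)]
  simp [d1]

lemma a3 (n : ℕ) : (P tA (n + 4)).coeff 3 = 1 := by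
  rw [PA_two, coeff_X_mul (n := 2), coeff_add, finsetSum_coeff]
  simp only [a2, co2, d0, b0, b1, sum_add_distrib, sing1 _ 0 (fun j => (P tD (j + 1)).coeff 2),
    sing1 _ 1 (fun j => (P tD (j + 1)).coeff 1)]
  simp [d1, d2]

lemma a4 (n : ℕ) : (P tA (n + 5)).coeff 4 = 5 + (n + 3).choose 2 := by
  rw [PA_two, coeff_X_mul (n := 3), coeff_add, finsetSum_coeff]
  simp only [a3, co3, d0, d1, b0, b1, sum_add_distrib, sing1 _ 0 (fun j => (P tD (j + 1)).coeff 3),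
    sing1 _ 1 (fun j => (P tD (j + 1)).coeff 2), sing2 _ 0 (fun j => (P tB j).coeff 2)]
  simp [d2, d3, b2, Nat.choose_succ_succ (n + 2) 1]
  omega

lemma card_a4 (n k : ℕ) : (P tA n).coeff k =
    ((treesOfNumNodesEq n).filter (fun t => tA t = k)).card := by
  rw [P, finsetSum_coeff, card_filter]
  refine sum_congr rfl fun t _ => ?_
  rw [coeff_X_pow]
  simp only [eq_comm]

/-- The word of a permutation. -/
def word {n : ℕ} (σ : Equiv.Perm (Fin n)) : List ℕ := List.ofFn (fun i => (σ i : ℕ))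

lemma before_ofFn {n : ℕ} (f : Fin n → ℕ) (y x : ℕ) :
    before (List.ofFn f) y x ↔ ∃ i j, i < j ∧ f i = y ∧ f j = x := by
  induction n with
  | zero => simp [before]
  | succ n ih =>
    rw [List.ofFn_succ, before, ih]
    simp only [Fin.exists_fin_succ, List.mem_ofFn, Fin.succ_lt_succ_iff]
    simp [Fin.succ_pos]

lemma word_inj {n : ℕ} {σ τ : Equiv.Perm (Fin n)} (h : word σ = word τ) : σ = τ := by
  ext i
  exact congrFun (List.ofFn_injective h) i

lemma word_nodup {n : ℕ} (σ : Equiv.Perm (Fin n)) : (word σ).Nodup := by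
  rw [word, List.nodup_ofFn]
  exact Fin.val_injective.comp σ.injective

lemma word_mem {n : ℕ} (σ : Equiv.Perm (Fin n)) (x : ℕ) : x ∈ word σ ↔ x < n := by
  rw [word, List.mem_ofFn]
  constructor
  · rintro ⟨i, rfl⟩; exact (σ i).2
  · intro h; exact ⟨σ.symm ⟨x, h⟩, by simp⟩

lemma before_word {n : ℕ} (σ : Equiv.Perm (Fin n)) (i j : Fin n) :
    before (word σ) (σ i) (σ j) ↔ i < j := by
  rw [word, before_ofFn]
  constructor
  · rintro ⟨a, b, h, h1, h2⟩
    have h1 := σ.injective (Fin.ext h1)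
    have h2 := σ.injective (Fin.ext h2)
    subst h1 h2; exact h
  · intro h; exact ⟨i, j, h, rfl, rfl⟩

lemma avl_word {n : ℕ} (σ : Equiv.Perm (Fin n)) : Avl (word σ) ↔ Avoids132 σ := by
  constructor
  · rintro h ⟨i, j, k, hij, hjk, h1, h2⟩
    exact h _ _ _ ((before_word σ i j).2 hij) ((before_word σ j k).2 hjk) h1 h2
  · intro h a b c h1 h2 hac hcb
    obtain ⟨i, rfl⟩ : ∃ i, (σ i : ℕ) = a := by
      simpa [word, List.mem_ofFn] using (before_mem h1).1
    obtain ⟨j, rfl⟩ : ∃ i, (σ i : ℕ) = b := by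
      simpa [word, List.mem_ofFn] using (before_mem h1).2
    obtain ⟨k, rfl⟩ : ∃ i, (σ i : ℕ) = c := by
      simpa [word, List.mem_ofFn] using (before_mem h2).2
    exact h ⟨i, j, k, (before_word σ i j).1 h1, (before_word σ j k).1 h2, hac, hcb⟩

lemma word_exists {w : List ℕ} (h : w.Nodup) (hm : ∀ x, x ∈ w ↔ x < w.length) :
    ∃ σ : Equiv.Perm (Fin w.length), word σ = w := by
  let f : Fin w.length → Fin w.length := fun i => ⟨w.get i, (hm _).1 (List.get_mem _ _)⟩
  have hf : Function.Injective f := by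
    intro i j hij
    exact (List.nodup_iff_injective_get.1 h) (Fin.mk.inj hij)
  refine ⟨Equiv.ofBijective f (Finite.injective_iff_bijective.1 hf), ?_⟩
  simp only [word, Equiv.ofBijective_apply, f]
  exact List.ofFn_get w

lemma matches_word {n : ℕ} (σ : Equiv.Perm (Fin n)) (i : Fin n) :
    MatchesMMP 0 1 1 1 σ i ↔ Bf (word σ) (σ i) ∧ Cf (word σ) (σ i) ∧ Df (word σ) (σ i) := by
  have key : ∀ p : Fin n → Prop, ∀ [DecidablePred p],
      1 ≤ (Finset.univ.filter p).card ↔ ∃ j, p j := by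
    intro p _
    rw [Nat.succ_le_iff, Finset.card_pos]
    simp [Finset.Nonempty]
  have ex : ∀ q : ℕ → Prop, (∀ y, q y → y ∈ word σ) → ((∃ y, q y) ↔ ∃ j, q (σ j)) := by
    intro q hq
    constructor
    · rintro ⟨y, hy⟩
      have := hq y hy
      rw [word, List.mem_ofFn] at this
      obtain ⟨j, rfl⟩ := this
      exact ⟨j, hy⟩
    · rintro ⟨j, hj⟩; exact ⟨_, hj⟩
  unfold MatchesMMP
  rw [key, key, key, Bf, Cf, Df, ex _ (fun y h => (before_mem h.1).1),
    ex _ (fun y h => (before_mem h.1).1), ex _ (fun y h => (before_mem h.1).2)]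
  simp only [before_word, Fin.lt_def, Nat.zero_le, true_and]

lemma countP_ofFn {n : ℕ} (f : Fin n → ℕ) (p : ℕ → Prop) [DecidablePred p] :
    (List.ofFn f).countP (fun x => decide (p x)) = (Finset.univ.filter (fun i => p (f i))).card := by
  rw [Finset.card_filter]
  induction n with
  | zero => simp
  | succ n ih =>
    rw [List.ofFn_succ, List.countP_cons, ih, Fin.sum_univ_succ, add_comm]
    simp

lemma mmp_add (n : ℕ) (σ : Equiv.Perm (Fin n)) : mmp 0 1 1 1 σ + dA (word σ) = n := by
  classical
  unfold mmp dA
  rw [word, countP_ofFn, ← word]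
  simp only [matches_word]
  rw [Finset.card_filter_add_card_filter_not]
  simp

lemma main_count (n k : ℕ) : ((Av132 n).filter (fun σ => dA (word σ) = k)).card =
    ((treesOfNumNodesEq n).filter (fun t => tA t = k)).card := by
  rw [← Finset.card_image_of_injective _ (f := word) (fun _ _ h => word_inj h),
    ← Finset.card_image_of_injective (f := enc 0) _ (fun _ _ h => enc_inj _ _ _ h)]
  congr 1
  ext w
  simp only [Finset.mem_image, Finset.mem_filter, Av132, Finset.mem_univ, true_and,
    mem_treesOfNumNodesEq]
  constructor
  · rintro ⟨σ, ⟨h1, h2⟩, rfl⟩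
    obtain ⟨t, ht, he⟩ := enc_surj n 0 (word σ) (word_nodup σ) (by simp [word_mem])
      ((avl_word σ).2 h1)
    exact ⟨t, ⟨ht, by rw [← dA_enc 0, he, h2]⟩, he⟩
  · rintro ⟨t, ⟨h1, h2⟩, rfl⟩
    have hl := (enc_length 0 t).trans h1
    have := word_exists (enc_nodup 0 t) (by simp [enc_mem, enc_length])
    rw [hl] at this
    obtain ⟨σ, hσ⟩ := this
    refine ⟨σ, ⟨?_, ?_⟩, hσ⟩
    · rw [← avl_word, hσ]; exact enc_avl 0 t
    · rw [hσ, dA_enc, h2]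

end M10

/-- for `n ≥ 5`, the coefficient of `x^{n-4}` in
`Q_{n,132}^{(0,1,1,1)}(x)` equals `5 + binom(n-2,2)`. -/
theorem stmt10 (n : ℕ) (hn : 5 ≤ n) :
    (Q n 0 1 1 1).coeff (n - 4) = ((5 + (n - 2).choose 2 : ℕ) : ℤ) := by
  have h : (Q n 0 1 1 1).coeff (n - 4) =
      (((Av132 n).filter (fun σ => M10.dA (M10.word σ) = 4)).card : ℤ) := by
    rw [Q, finsetSum_coeff, Finset.card_filter, Nat.cast_sum]
    refine Finset.sum_congr rfl fun σ _ => ?_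
    have := M10.mmp_add n σ
    rw [coeff_X_pow]
    split_ifs <;> first | rfl | omega
  rw [h, M10.main_count, ← M10.card_a4]
  obtain ⟨k, rfl⟩ := Nat.exists_eq_add_of_le' hn
  rw [M10.a4]
  rfl
end
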